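/- arXiv:math/0303088 — 4 statements merged into one kernel-verified Lean document; each statement's English description precedes it below -/
import Mathlib

section
/- Suppose all the tau functions are nonzero and satisfy the bilinear equations ⟨J,i⟩ for 1 ≤ J ≤ 4 and 1 ≤ i ≤ n−1. Set x = [λ; τ3, W, τ2] and y = [κ; τ2, N, τ1], and define v₊ = Σ_{i=1}^{n−2} (y_1⋯y_i/(x_1⋯x_{i−1}))·(1/x_i + 1/ȳ_i) + (y_1⋯y_{n−1}/(x_1⋯x_{n−2}))·(y_n/x_{n−1} + 1/ȳ_{n−1}) and v₋ = Σ_{i=1}^{n−2} (x̄_1⋯x̄_i/(ȳ_1⋯ȳ_{i−1}))·(1/x_i + 1/ȳ_i) + (x̄_1⋯x̄_{n−1}/(ȳ_1⋯ȳ_{n−2}·y_n))·(y_n/x_{n−1} + 1/ȳ_{n−1}). Then v₊ = (β·τ2_0/(α·τ1_0·τ3_0))·( τ4_0 − (λ_1⋯λ_n/(κ_1⋯κ_n))·τ2_0·τ4_n/τ2_n ) and v₋ = (β·τ2_0/(α·τ1_0·τ3_0))·( −τ4_0 + (κ̄_1⋯κ̄_{n−1}/(λ̄_1⋯λ̄_{n−1}))·τ2_0·τ4_n/τ2_n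 ). -/
/-- The `D^(1)_n` bilinear equation `⟨J,i⟩` on the tau functions. -/
def BE {F : Type*} [Field F] (n : ℕ)
    (lam lamb kap kapb S W N E t0 t1 t2 t3 t4 : ℕ → F)
    (α β : F) (J i : ℕ) : Prop :=
  if J = 1 then
    if i = 0 then kapb 1 * N 1 * t4 1 - lamb 1 * E 1 * t2 1 = α * t0 0 * t1 0
    else if i = 1 then kap 1 * N 1 * t4 0 - lam 1 * E 1 * t2 0 = α * t0 1 * t1 1
    else if i = n - 1 then
      kap (n - 1) * kap n * E (n - 2) * t2 n - lam (n - 1) * lam n * N (n - 2) * t4 n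
        = α * t0 (n - 1) * t1 n
    else if i = n then
      kap (n - 1) * E (n - 2) * t2 (n - 1) - lam (n - 1) * N (n - 2) * t4 (n - 1)
        = α * t0 n * t1 (n - 1)
    else kap i * E (i - 1) * N i - lam i * N (i - 1) * E i = α * t0 i * t1 i
  else if J = 2 then
    if i = 0 then kap 1 * N 1 * t3 1 + lamb 1 * W 1 * t1 1 = β * t0 0 * t2 0
    else if i = 1 then kapb 1 * N 1 * t3 0 + lam 1 * W 1 * t1 0 = β * t0 1 * t2 1
    else if i = n - 1 then
      kap n * kapb (n - 1) * W (n - 2) * t1 (n - 1) + lam (n - 1) * N (n - 2) * t3 (n - 1)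
        = β * t0 (n - 1) * t2 (n - 1)
    else if i = n then
      kapb (n - 1) * W (n - 2) * t1 n + lam (n - 1) * lam n * N (n - 2) * t3 n
        = β * t0 n * t2 n
    else kapb i * W (i - 1) * N i + lam i * N (i - 1) * W i = β * t0 i * t2 i
  else if J = 3 then
    if i = 0 then kap 1 * S 1 * t2 1 - lam 1 * W 1 * t4 1 = α * t0 0 * t3 0
    else if i = 1 then kapb 1 * S 1 * t2 0 - lamb 1 * W 1 * t4 0 = α * t0 1 * t3 1
    else if i = n - 1 then
      kapb (n - 1) * W (n - 2) * t4 n - lamb (n - 1) * S (n - 2) * t2 n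
        = α * t0 (n - 1) * t3 n
    else if i = n then
      kap n * kapb (n - 1) * W (n - 2) * t4 (n - 1) - lam n * lamb (n - 1) * S (n - 2) * t2 (n - 1)
        = α * t0 n * t3 (n - 1)
    else kapb i * W (i - 1) * S i - lamb i * S (i - 1) * W i = α * t0 i * t3 i
  else if J = 4 then
    if i = 0 then kapb 1 * S 1 * t1 1 + lam 1 * E 1 * t3 1 = β * t0 0 * t4 0
    else if i = 1 then kap 1 * S 1 * t1 0 + lamb 1 * E 1 * t3 0 = β * t0 1 * t4 1
    else if i = n - 1 then
      kap (n - 1) * E (n - 2) * t3 (n - 1) + lam n * lamb (n - 1) * S (n - 2) * t1 (n - 1)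
        = β * t0 (n - 1) * t4 (n - 1)
    else if i = n then
      kap (n - 1) * kap n * E (n - 2) * t3 n + lamb (n - 1) * S (n - 2) * t1 n
        = β * t0 n * t4 n
    else kap i * E (i - 1) * S i + lamb i * S (i - 1) * E i = β * t0 i * t4 i
  else True

/-- The level `ℓ(x)` of an element of `B`, represented by the pair of families
`x = (x_1,…,x_n)` and `xb = (x̄_1,…,x̄_{n-1})`. -/
def lev {F : Type*} [Field F] (n : ℕ) (x xb : ℕ → F) : F :=
  (∏ i ∈ Finset.Icc 1 n, x i) * ∏ i ∈ Finset.Icc 1 (n - 1), xb i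

/-- The functions `V_0, V_1, …, V_{n-1}` of the `D^(1)_n` tropical `R`. -/
def Vf {F : Type*} [Field F] (n : ℕ) (x xb y yb : ℕ → F) : ℕ → F
  | 0 =>
      lev n x xb * (y 1 / yb 1)
      + lev n x xb *
          ∑ m ∈ Finset.Icc 2 (n - 1), (∏ i ∈ Finset.Icc 1 (m - 1), y i / x i) * (1 + y m / yb m)
      + x n * y n * ∏ i ∈ Finset.Icc 1 (n - 1), xb i * y i
      + lev n y yb * (xb 1 / x 1)
      + lev n y yb *
          ∑ m ∈ Finset.Icc 2 (n - 1), (∏ i ∈ Finset.Icc 1 (m - 1), xb i / yb i) * (1 + xb m / x m)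
      + ∏ i ∈ Finset.Icc 1 (n - 1), xb i * y i
  | (i + 1) =>
      if i + 1 = n - 1 then
        (yb (i + 1) / y n) * (y n * Vf n x xb y yb i / xb (i + 1)
          + (lev n x xb - lev n y yb) * (y n / x (i + 1) + 1 / yb (i + 1)))
      else
        yb (i + 1) * (Vf n x xb y yb i / xb (i + 1)
          + (lev n x xb - lev n y yb) * (1 / x (i + 1) + 1 / yb (i + 1)))

/-- `σ_1` (first component): swap the indices `1` of the two families. -/
def sw1 {F : Type*} (x xb : ℕ → F) : ℕ → F := fun i => if i = 1 then xb 1 else x i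

/-- `σ_n` on the unbarred family. -/
def snx {F : Type*} [Field F] (n : ℕ) (x : ℕ → F) : ℕ → F :=
  fun i => if i = n - 1 then x (n - 1) * x n else if i = n then (x n)⁻¹ else x i

/-- `σ_n` on the barred family. -/
def snxb {F : Type*} [Field F] (n : ℕ) (x xb : ℕ → F) : ℕ → F :=
  fun i => if i = n - 1 then xb (n - 1) * x n else xb i

/-- `σ✶` (unbarred part of the first component of `σ✶(x,y)`, built from `y`). -/
def stx {F : Type*} (n : ℕ) (y yb : ℕ → F) : ℕ → F := fun i => if i = n then y n else yb i

/-- `V_i^{σ_1}`. -/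
def Vs1 {F : Type*} [Field F] (n : ℕ) (x xb y yb : ℕ → F) : ℕ → F :=
  Vf n (sw1 x xb) (sw1 xb x) (sw1 y yb) (sw1 yb y)

/-- `V_i^{σ_n}`. -/
def Vsn {F : Type*} [Field F] (n : ℕ) (x xb y yb : ℕ → F) : ℕ → F :=
  Vf n (snx n x) (snxb n x xb) (snx n y) (snxb n y yb)

/-- `V_i^{σ✶}`. -/
def Vst {F : Type*} [Field F] (n : ℕ) (x xb y yb : ℕ → F) : ℕ → F :=
  Vf n (stx n y yb) y (stx n x xb) x

/-- The functions `U_1, …, U_{n-1}` of the `D^(1)_n` tropical `R`. -/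
def Uf {F : Type*} [Field F] (n : ℕ) (x xb y yb : ℕ → F) : ℕ → F := fun i =>
  if i = 1 then Vf n x xb y yb 0 * Vs1 n x xb y yb 0
  else if i = n - 1 then Vf n x xb y yb (n - 1) * Vst n x xb y yb (n - 1)
  else (1 / x i + 1 / yb i)⁻¹ *
    (Vf n x xb y yb i * Vst n x xb y yb (i - 1) / y i
      + Vf n x xb y yb (i - 1) * Vst n x xb y yb i / xb i)

/-- unbarred part `x'` of the output of the tropical `R`. -/
def Rx {F : Type*} [Field F] (n : ℕ) (x xb y yb : ℕ → F) : ℕ → F := fun i =>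
  if i = 1 then y 1 * Vs1 n x xb y yb 0 / Vf n x xb y yb 1
  else if i = n then y n * Vf n x xb y yb (n - 1) / Vsn n x xb y yb (n - 1)
  else y i * Vf n x xb y yb (i - 1) * Uf n x xb y yb i
        / (Vf n x xb y yb i * Uf n x xb y yb (i - 1))

/-- barred part `x̄'` of the output of the tropical `R`. -/
def Rxb {F : Type*} [Field F] (n : ℕ) (x xb y yb : ℕ → F) : ℕ → F := fun i =>
  if i = 1 then yb 1 * Vf n x xb y yb 0 / Vf n x xb y yb 1
  else yb i * Vf n x xb y yb (i - 1) / Vf n x xb y yb i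

/-- unbarred part `y'` of the output of the tropical `R`. -/
def Ry {F : Type*} [Field F] (n : ℕ) (x xb y yb : ℕ → F) : ℕ → F := fun i =>
  if i = 1 then x 1 * Vf n x xb y yb 0 / Vst n x xb y yb 1
  else if i = n then x n * Vsn n x xb y yb (n - 1) / Vf n x xb y yb (n - 1)
  else x i * Vst n x xb y yb (i - 1) / Vst n x xb y yb i

/-- barred part `ȳ'` of the output of the tropical `R`. -/
def Ryb {F : Type*} [Field F] (n : ℕ) (x xb y yb : ℕ → F) : ℕ → F := fun i =>
  if i = 1 then xb 1 * Vs1 n x xb y yb 0 / Vst n x xb y yb 1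
  else xb i * Vst n x xb y yb (i - 1) * Uf n x xb y yb i
        / (Vst n x xb y yb i * Uf n x xb y yb (i - 1))

/-- Admissibility: all the quantities `V_i`, `U_i` and their `σ`-transforms appearing in
the formulas of the tropical `R` are nonzero. -/
def Adm {F : Type*} [Field F] (n : ℕ) (x xb y yb : ℕ → F) : Prop :=
  (∀ i ≤ n - 1, Vf n x xb y yb i ≠ 0) ∧
  (∀ i ≤ n - 1, Vst n x xb y yb i ≠ 0) ∧
  Vs1 n x xb y yb 0 ≠ 0 ∧
  Vsn n x xb y yb (n - 1) ≠ 0 ∧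
  (∀ i, 1 ≤ i → i ≤ n - 1 → Uf n x xb y yb i ≠ 0)

/-- The unbarred part of `[μ; τ, C, τ']`. -/
def brkX {F : Type*} [Field F] (n : ℕ) (μ τ C τ' : ℕ → F) : ℕ → F := fun i =>
  if i = 1 then (μ 1)⁻¹ * (τ 0 * τ' 1 / C 1)
  else if i = 2 then (μ 2)⁻¹ * (C 1 * τ' 2 / (C 2 * τ' 0 * τ' 1))
  else if i = n - 1 then (μ (n - 1))⁻¹ * (C (n - 2) * τ' (n - 1) / (τ (n - 1) * τ' (n - 2)))
  else if i = n then (μ n)⁻¹ * (τ (n - 1) * τ' n / (τ n * τ' (n - 1)))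
  else (μ i)⁻¹ * (C (i - 1) * τ' i / (C i * τ' (i - 1)))

/-- The barred part of `[μ; τ, C, τ']` (here `μb` is the barred part of `μ`). -/
def brkXb {F : Type*} [Field F] (n : ℕ) (μb τ C τ' : ℕ → F) : ℕ → F := fun i =>
  if i = 1 then (μb 1)⁻¹ * (τ 1 * τ' 0 / C 1)
  else if i = 2 then (μb 2)⁻¹ * (C 1 * τ 2 / (C 2 * τ 0 * τ 1))
  else if i = n - 1 then (μb (n - 1))⁻¹ * (C (n - 2) * τ n / (τ (n - 2) * τ' n))
  else (μb i)⁻¹ * (C (i - 1) * τ i / (C i * τ (i - 1)))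

theorem brkX_of_mid {F : Type*} [Field F] {n i : ℕ} (hi : 2 ≤ i) (hin : i + 3 ≤ n)
    (μ τ C τ' : ℕ → F) :
    brkX n μ τ C τ' (i + 1) = (μ (i + 1))⁻¹ * (C i * τ' (i + 1) / (C (i + 1) * τ' i)) := by
  rw [brkX, if_neg (by omega), if_neg (by omega), if_neg (by omega), if_neg (by omega)]
  rfl

theorem brkXb_of_mid {F : Type*} [Field F] {n i : ℕ} (hi : 2 ≤ i) (hin : i + 3 ≤ n)
    (μ τ C τ' : ℕ → F) :
    brkXb n μ τ C τ' (i + 1) = (μ (i + 1))⁻¹ * (C i * τ (i + 1) / (C (i + 1) * τ i)) := by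
  rw [brkXb, if_neg (by omega), if_neg (by omega), if_neg (by omega)]
  rfl

theorem prod_Icc_brkX {F : Type*} [Field F] {n : ℕ} (μ τ C τ' : ℕ → F)
    (hC : ∀ i, 1 ≤ i → i ≤ n - 2 → C i ≠ 0) (hτ' : ∀ i ≤ n, τ' i ≠ 0) {i : ℕ} (hi : 2 ≤ i) :
    i + 2 ≤ n → ∏ j ∈ Finset.Icc 1 i, brkX n μ τ C τ' j
      = τ 0 * τ' i / ((∏ j ∈ Finset.Icc 1 i, μ j) * C i * τ' 0) := by
  induction i, hi using Nat.le_induction with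
  | base =>
    intro hn
    have := hC 1 (by omega) (by omega)
    have := hτ' 1 (by omega)
    simp only [brkX, Finset.prod_Icc_succ_top (show 1 ≤ 1 + 1 by norm_num), Finset.Icc_self,
      Finset.prod_singleton]
    simp
    field
  | succ i hi ih =>
    intro hn
    have := hC i (by omega) (by omega)
    have := hτ' i (by omega)
    rw [Finset.prod_Icc_succ_top (by omega), Finset.prod_Icc_succ_top (by omega),
      ih (by omega), brkX_of_mid hi hn]
    field

theorem prod_Icc_brkXb {F : Type*} [Field F] {n : ℕ} (μ τ C τ' : ℕ → F)
    (hC : ∀ i, 1 ≤ i → i ≤ n - 2 → C i ≠ 0) (hτ : ∀ i ≤ n, τ i ≠ 0) {i : ℕ} (hi : 2 ≤ i) :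
    i + 2 ≤ n → ∏ j ∈ Finset.Icc 1 i, brkXb n μ τ C τ' j
      = τ' 0 * τ i / ((∏ j ∈ Finset.Icc 1 i, μ j) * C i * τ 0) := by
  induction i, hi using Nat.le_induction with
  | base =>
    intro hn
    have := hC 1 (by omega) (by omega)
    have := hτ 1 (by omega)
    simp only [brkXb, Finset.prod_Icc_succ_top (show 1 ≤ 1 + 1 by norm_num), Finset.Icc_self,
      Finset.prod_singleton]
    simp
    field
  | succ i hi ih =>
    intro hn
    have := hC i (by omega) (by omega)
    have := hτ i (by omega)
    rw [Finset.prod_Icc_succ_top (by omega), Finset.prod_Icc_succ_top (by omega),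
      ih (by omega), brkXb_of_mid hi hn]
    field

theorem stmt12 {F : Type*} [Field F] (n : ℕ) (hn : 4 ≤ n)
    (lam lamb kap kapb : ℕ → F) (α β : F)
    (hlam : ∀ i, 1 ≤ i → i ≤ n → lam i ≠ 0)
    (hlamb : ∀ i, 1 ≤ i → i ≤ n - 1 → lamb i ≠ 0)
    (hkap : ∀ i, 1 ≤ i → i ≤ n → kap i ≠ 0)
    (hkapb : ∀ i, 1 ≤ i → i ≤ n - 1 → kapb i ≠ 0)
    (hα : α ≠ 0) (hβ : β ≠ 0)
    (S W N E t0 t1 t2 t3 t4 : ℕ → F)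
    (hS : ∀ i, 1 ≤ i → i ≤ n - 2 → S i ≠ 0)
    (hW : ∀ i, 1 ≤ i → i ≤ n - 2 → W i ≠ 0)
    (hN : ∀ i, 1 ≤ i → i ≤ n - 2 → N i ≠ 0)
    (hE : ∀ i, 1 ≤ i → i ≤ n - 2 → E i ≠ 0)
    (ht0 : ∀ i ≤ n, t0 i ≠ 0) (ht1 : ∀ i ≤ n, t1 i ≠ 0) (ht2 : ∀ i ≤ n, t2 i ≠ 0)
    (ht3 : ∀ i ≤ n, t3 i ≠ 0) (ht4 : ∀ i ≤ n, t4 i ≠ 0)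
    (heqs : ∀ J i, 1 ≤ J → J ≤ 4 → 1 ≤ i → i ≤ n - 1 →
      BE n lam lamb kap kapb S W N E t0 t1 t2 t3 t4 α β J i)
    (x xb y yb : ℕ → F)
    (hx : x = brkX n lam t3 W t2) (hxb : xb = brkXb n lamb t3 W t2)
    (hy : y = brkX n kap t2 N t1) (hyb : yb = brkXb n kapb t2 N t1)
    (vp vm : F)
    (hvp : vp = (∑ i ∈ Finset.Icc 1 (n - 2),
        ((∏ j ∈ Finset.Icc 1 i, y j) / ∏ j ∈ Finset.Icc 1 (i - 1), x j)
          * (1 / x i + 1 / yb i))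
      + ((∏ j ∈ Finset.Icc 1 (n - 1), y j) / ∏ j ∈ Finset.Icc 1 (n - 2), x j)
          * (y n / x (n - 1) + 1 / yb (n - 1)))
    (hvm : vm = (∑ i ∈ Finset.Icc 1 (n - 2),
        ((∏ j ∈ Finset.Icc 1 i, xb j) / ∏ j ∈ Finset.Icc 1 (i - 1), yb j)
          * (1 / x i + 1 / yb i))
      + ((∏ j ∈ Finset.Icc 1 (n - 1), xb j) / ((∏ j ∈ Finset.Icc 1 (n - 2), yb j) * y n))
          * (y n / x (n - 1) + 1 / yb (n - 1))) :
    vp = β * t2 0 / (α * t1 0 * t3 0)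
        * (t4 0 - (∏ i ∈ Finset.Icc 1 n, lam i) / (∏ i ∈ Finset.Icc 1 n, kap i)
            * t2 0 * t4 n / t2 n) ∧
    vm = β * t2 0 / (α * t1 0 * t3 0)
        * (-t4 0 + (∏ i ∈ Finset.Icc 1 (n - 1), kapb i) / (∏ i ∈ Finset.Icc 1 (n - 1), lamb i)
            * t2 0 * t4 n / t2 n) := by
  have hprod : ∀ {μ : ℕ → F} {m : ℕ}, (∀ i, 1 ≤ i → i ≤ m → μ i ≠ 0) →
      ∀ i ≤ m, ∏ j ∈ Finset.Icc 1 i, μ j ≠ 0 := fun h i hi =>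
    Finset.prod_ne_zero_iff.2 fun j hj =>
      h j (Finset.mem_Icc.1 hj).1 ((Finset.mem_Icc.1 hj).2.trans hi)
  have pX := fun i => prod_Icc_brkX (n := n) (i := i) lam t3 W t2 hW ht2
  have pY := fun i => prod_Icc_brkX (n := n) (i := i) kap t2 N t1 hN ht1
  have pXb := fun i => prod_Icc_brkXb (n := n) (i := i) lamb t3 W t2 hW ht3
  have pYb := fun i => prod_Icc_brkXb (n := n) (i := i) kapb t2 N t1 hN ht2
  rw [← hx] at pX
  rw [← hy] at pY
  rw [← hxb] at pXb
  rw [← hyb] at pYb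
  have := ht1 0 (by omega)
  have := ht2 0 (by omega)
  have := ht3 0 (by omega)
  have := ht1 1 (by omega)
  have := ht2 1 (by omega)
  have := ht3 1 (by omega)
  have := hW 1 (by omega) (by omega)
  have := hN 1 (by omega) (by omega)
  have := hkap 1 (by omega) (by omega)
  have := hlam 1 (by omega) (by omega)
  have := hkapb 1 (by omega) (by omega)
  have := hlamb 1 (by omega) (by omega)
  have x1 : x 1 = (lam 1)⁻¹ * (t3 0 * t2 1 / W 1) := by simp [hx, brkX]
  have y1 : y 1 = (kap 1)⁻¹ * (t2 0 * t1 1 / N 1) := by simp [hy, brkX]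
  have xb1 : xb 1 = (lamb 1)⁻¹ * (t3 1 * t2 0 / W 1) := by simp [hxb, brkXb]
  have yb1 : yb 1 = (kapb 1)⁻¹ * (t2 1 * t1 0 / N 1) := by simp [hyb, brkXb]
  have pair1 : 1 / x 1 + 1 / yb 1 = β * t0 1 / (t3 0 * t1 0) := by
    have h := heqs 2 1 (by omega) (by omega) (by omega) (by omega)
    simp only [BE, reduceIte, OfNat.ofNat_ne_one, one_ne_zero] at h
    rw [← mul_left_inj' (ht2 1 (by omega)), div_mul_eq_mul_div, ← h, x1, yb1]
    field
  have e11 : t0 1 = (kap 1 * N 1 * t4 0 - lam 1 * E 1 * t2 0) / (α * t1 1) := by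
    have h := heqs 1 1 (by omega) (by omega) (by omega) (by omega)
    simp only [BE, reduceIte, one_ne_zero] at h
    rw [h]; field
  have e31 : t0 1 = (kapb 1 * S 1 * t2 0 - lamb 1 * W 1 * t4 0) / (α * t3 1) := by
    have h := heqs 3 1 (by omega) (by omega) (by omega) (by omega)
    simp only [BE, reduceIte, one_ne_zero, OfNat.ofNat_ne_one, Nat.reduceEqDiff] at h
    rw [h]; field
  have e1 : ∀ i, 1 ≤ i → i + 3 ≤ n → t0 (i + 1) =
      (kap (i + 1) * E i * N (i + 1) - lam (i + 1) * N i * E (i + 1)) / (α * t1 (i + 1)) := by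
    intro i hi hin
    have h := heqs 1 (i + 1) (by omega) (by omega) (by omega) (by omega)
    rw [BE, if_pos rfl, if_neg (by omega), if_neg (by omega), if_neg (by omega),
      if_neg (by omega), Nat.add_sub_cancel] at h
    have := ht1 (i + 1) (by omega)
    rw [h]; field
  have e3 : ∀ i, 1 ≤ i → i + 3 ≤ n → t0 (i + 1) =
      (kapb (i + 1) * W i * S (i + 1) - lamb (i + 1) * S i * W (i + 1)) / (α * t3 (i + 1)) := by
    intro i hi hin
    have h := heqs 3 (i + 1) (by omega) (by omega) (by omega) (by omega)
    rw [BE, if_neg (by omega), if_neg (by omega), if_pos rfl, if_neg (by omega),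
      if_neg (by omega), if_neg (by omega), if_neg (by omega), Nat.add_sub_cancel] at h
    have := ht3 (i + 1) (by omega)
    rw [h]; field
  have e2 : ∀ i, 1 ≤ i → i + 3 ≤ n →
      kapb (i + 1) * W i * N (i + 1) + lam (i + 1) * N i * W (i + 1)
        = β * t0 (i + 1) * t2 (i + 1) := by
    intro i hi hin
    have h := heqs 2 (i + 1) (by omega) (by omega) (by omega) (by omega)
    rwa [BE, if_neg (by omega), if_pos rfl, if_neg (by omega),
      if_neg (by omega), if_neg (by omega), if_neg (by omega), Nat.add_sub_cancel] at h
  have pair2 : 1 / x 2 + 1 / yb 2 = β * t0 2 * t2 0 * t2 1 / (W 1 * N 1) := by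
    have := ht2 2 (by omega)
    have h := e2 1 le_rfl (by omega)
    rw [← mul_left_inj' (ht2 2 (by omega)), div_mul_eq_mul_div,
      show β * t0 2 * t2 0 * t2 1 * t2 2 = (β * t0 2 * t2 2) * t2 0 * t2 1 by ring, ← h, hx, hyb]
    have := hW 2 (by omega) (by omega)
    have := hN 2 (by omega) (by omega)
    have := hlam 2 (by omega) (by omega)
    have := hkapb 2 (by omega) (by omega)
    simp only [brkX, brkXb, OfNat.ofNat_ne_one, reduceIte, Nat.reduceAdd]
    field
  have pair : ∀ i, 2 ≤ i → i + 3 ≤ n →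
      1 / x (i + 1) + 1 / yb (i + 1) = β * t0 (i + 1) * t2 i / (W i * N i) := by
    intro i hi hin
    have := ht2 (i + 1) (by omega)
    have h := e2 i (by omega) hin
    rw [← mul_left_inj' (ht2 (i + 1) (by omega)), div_mul_eq_mul_div,
      show β * t0 (i + 1) * t2 i * t2 (i + 1) = (β * t0 (i + 1) * t2 (i + 1)) * t2 i by ring,
      ← h, hx, hyb, brkX_of_mid hi hin, brkXb_of_mid hi hin]
    have := hW i (by omega) (by omega)
    have := hN i (by omega) (by omega)
    have := ht2 i (by omega)
    have := hW (i + 1) (by omega) (by omega)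
    have := hN (i + 1) (by omega) (by omega)
    have := hlam (i + 1) (by omega) (by omega)
    have := hkapb (i + 1) (by omega) (by omega)
    field
  have sumP : ∀ m, 2 ≤ m → m + 2 ≤ n → (∑ i ∈ Finset.Icc 1 m,
        ((∏ j ∈ Finset.Icc 1 i, y j) / ∏ j ∈ Finset.Icc 1 (i - 1), x j)
          * (1 / x i + 1 / yb i)) = β * t2 0 / (α * t1 0 * t3 0)
        * (t4 0 - (∏ i ∈ Finset.Icc 1 m, lam i) / (∏ i ∈ Finset.Icc 1 m, kap i)
            * t2 0 * E m / N m) := by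
    intro m hm
    induction m, hm using Nat.le_induction with
    | base =>
      intro hn
      have hp := pY 2 le_rfl hn
      have := ht1 2 (by omega)
      have := hN 2 (by omega) (by omega)
      have := hkap 2 (by omega) (by omega)
      have h := e1 1 le_rfl (by omega)
      simp only [Nat.reduceAdd] at h
      rw [Finset.sum_Icc_succ_top (by norm_num), hp]
      simp only [Nat.reduceAdd, Finset.Icc_self, Finset.sum_singleton,
        Finset.prod_singleton, Nat.sub_self, Nat.reduceSub, pair1, pair2, h,
        Finset.prod_Icc_succ_top (show 1 ≤ 1 + 1 by norm_num),
        Finset.Icc_eq_empty (show ¬ 1 ≤ 0 by norm_num), Finset.prod_empty]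
      rw [e11, x1, y1]
      field
    | succ m hm ih =>
      intro hn
      have := hprod hlam m (by omega)
      have := hprod hkap m (by omega)
      have := ht1 (m + 1) (by omega)
      have := ht2 m (by omega)
      have := hW m (by omega) (by omega)
      have := hN m (by omega) (by omega)
      have := hN (m + 1) (by omega) (by omega)
      have := hkap (m + 1) (by omega) (by omega)
      rw [Finset.sum_Icc_succ_top (by omega), ih (by omega), pY (m + 1) (by omega) hn,
        Nat.add_sub_cancel, pX m hm (by omega), pair m hm hn, e1 m (by omega) hn,
        Finset.prod_Icc_succ_top (by omega), Finset.prod_Icc_succ_top (by omega)]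
      field
  have sumM : ∀ m, 2 ≤ m → m + 2 ≤ n → (∑ i ∈ Finset.Icc 1 m,
        ((∏ j ∈ Finset.Icc 1 i, xb j) / ∏ j ∈ Finset.Icc 1 (i - 1), yb j)
          * (1 / x i + 1 / yb i)) = β * t2 0 / (α * t1 0 * t3 0)
        * (-t4 0 + (∏ i ∈ Finset.Icc 1 m, kapb i) / (∏ i ∈ Finset.Icc 1 m, lamb i)
            * t2 0 * S m / W m) := by
    intro m hm
    induction m, hm using Nat.le_induction with
    | base =>
      intro hn
      have hp := pXb 2 le_rfl hn
      have := ht3 2 (by omega)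
      have := hW 2 (by omega) (by omega)
      have := hlamb 2 (by omega) (by omega)
      have h := e3 1 le_rfl (by omega)
      simp only [Nat.reduceAdd] at h
      rw [Finset.sum_Icc_succ_top (by norm_num), hp]
      simp only [Nat.reduceAdd, Finset.Icc_self, Finset.sum_singleton,
        Finset.prod_singleton, Nat.sub_self, Nat.reduceSub, pair1, pair2, h,
        Finset.prod_Icc_succ_top (show 1 ≤ 1 + 1 by norm_num),
        Finset.Icc_eq_empty (show ¬ 1 ≤ 0 by norm_num), Finset.prod_empty]
      rw [e31, xb1, yb1]
      field
    | succ m hm ih =>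
      intro hn
      have := hprod hlamb m (by omega)
      have := hprod hkapb m (by omega)
      have := ht3 (m + 1) (by omega)
      have := ht2 m (by omega)
      have := hW m (by omega) (by omega)
      have := hN m (by omega) (by omega)
      have := hW (m + 1) (by omega) (by omega)
      have := hlamb (m + 1) (by omega) (by omega)
      rw [Finset.sum_Icc_succ_top (by omega), ih (by omega), pXb (m + 1) (by omega) hn,
        Nat.add_sub_cancel, pYb m hm (by omega), pair m hm hn, e3 m (by omega) hn,
        Finset.prod_Icc_succ_top (by omega), Finset.prod_Icc_succ_top (by omega)]
      field
  obtain ⟨m, rfl⟩ : ∃ m, n = m + 2 := ⟨n - 2, by omega⟩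
  have hm : 2 ≤ m := by omega
  simp only [Nat.add_sub_cancel, show m + 2 - 1 = m + 1 by omega] at *
  have := hprod hlam m (by omega)
  have := hprod hkap m (by omega)
  have := hprod hlamb m (by omega)
  have := hprod hkapb m (by omega)
  have := hW m (by omega) (by omega)
  have := hN m (by omega) (by omega)
  have := ht2 m (by omega)
  have := ht1 (m + 1) (by omega)
  have := ht2 (m + 1) (by omega)
  have := ht3 (m + 1) (by omega)
  have := ht1 (m + 2) (by omega)
  have := ht2 (m + 2) (by omega)
  have := ht3 (m + 2) (by omega)
  have := hlam (m + 1) (by omega) (by omega)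
  have := hlamb (m + 1) (by omega) (by omega)
  have := hkap (m + 1) (by omega) (by omega)
  have := hkap (m + 2) (by omega) (by omega)
  have := hkapb (m + 1) (by omega) (by omega)
  have xm : x (m + 1) = (lam (m + 1))⁻¹ * (W m * t2 (m + 1) / (t3 (m + 1) * t2 m)) := by
    rw [hx, brkX, if_neg (by omega), if_neg (by omega), if_pos (by omega)]
    rfl
  have ym : y (m + 1) = (kap (m + 1))⁻¹ * (N m * t1 (m + 1) / (t2 (m + 1) * t1 m)) := by
    rw [hy, brkX, if_neg (by omega), if_neg (by omega), if_pos (by omega)]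
    rfl
  have xbm : xb (m + 1) = (lamb (m + 1))⁻¹ * (W m * t3 (m + 2) / (t3 m * t2 (m + 2))) := by
    rw [hxb, brkXb, if_neg (by omega), if_neg (by omega), if_pos (by omega)]
    rfl
  have ybm : yb (m + 1) = (kapb (m + 1))⁻¹ * (N m * t2 (m + 2) / (t2 m * t1 (m + 2))) := by
    rw [hyb, brkXb, if_neg (by omega), if_neg (by omega), if_pos (by omega)]
    rfl
  have yn : y (m + 2) =
      (kap (m + 2))⁻¹ * (t2 (m + 1) * t1 (m + 2) / (t2 (m + 2) * t1 (m + 1))) := by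
    rw [hy, brkX, if_neg (by omega), if_neg (by omega), if_neg (by omega), if_pos rfl]
    rfl
  have hBE1 := heqs 1 (m + 1) (by omega) (by omega) (by omega) (by omega)
  rw [BE, if_pos rfl, if_neg (by omega), if_neg (by omega), if_pos (by omega)] at hBE1
  have hBE2 := heqs 2 (m + 1) (by omega) (by omega) (by omega) (by omega)
  rw [BE, if_neg (by omega), if_pos rfl, if_neg (by omega), if_neg (by omega),
    if_pos (by omega)] at hBE2
  have hBE3 := heqs 3 (m + 1) (by omega) (by omega) (by omega) (by omega)
  rw [BE, if_neg (by omega), if_neg (by omega), if_pos rfl, if_neg (by omega), if_neg (by omega),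
    if_pos (by omega)] at hBE3
  simp only [Nat.add_sub_cancel, show m + 2 - 1 = m + 1 by omega] at hBE1 hBE2 hBE3
  have pairm : y (m + 2) / x (m + 1) + 1 / yb (m + 1) =
      β * t0 (m + 1) * t2 (m + 1) * (t1 (m + 2) * t2 m) /
        (kap (m + 2) * t2 (m + 2) * t1 (m + 1) * W m * N m) := by
    rw [← hBE2, xm, ybm, yn]
    field
  have := ht1 m (by omega)
  have := ht3 m (by omega)
  rw [pairm, Finset.prod_Icc_succ_top (by omega), pX m hm le_rfl, pY m hm le_rfl, ym,
    sumP m hm le_rfl] at hvp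
  rw [pairm, Finset.prod_Icc_succ_top (by omega), pXb m hm le_rfl, pYb m hm le_rfl, xbm, yn,
    sumM m hm le_rfl] at hvm
  constructor
  · rw [hvp, show t0 (m + 1) = (kap (m + 1) * kap (m + 2) * E m * t2 (m + 2)
        - lam (m + 1) * lam (m + 2) * N m * t4 (m + 2)) / (α * t1 (m + 2)) by rw [hBE1]; field,
      Finset.prod_Icc_succ_top (by omega), Finset.prod_Icc_succ_top (by omega),
      Finset.prod_Icc_succ_top (by omega), Finset.prod_Icc_succ_top (by omega)]
    field
  · rw [hvm, show t0 (m + 1) = (kapb (m + 1) * W m * t4 (m + 2)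
        - lamb (m + 1) * S m * t2 (m + 2)) / (α * t3 (m + 2)) by rw [hBE3]; field,
      Finset.prod_Icc_succ_top (by omega), Finset.prod_Icc_succ_top (by omega)]
    field
end

section
/- (Bilinearization of the tropical R.) Suppose all the tau functions are nonzero and satisfy all the bilinear equations ⟨J,i⟩ (1 ≤ J ≤ 4, 0 ≤ i ≤ n). Set x = [λ; τ3, W, τ2], y = [κ; τ2, N, τ1], x′ = [κ; τ3, S, τ4], y′ = [λ; τ4, E, τ1]. Then the pair (x,y) is admissible for the D^(1)_n tropical R and R(x,y) = (x′,y′), i.e., every component formula of the tropical R maps (x,y) to exactly (x′,y′). -/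
/-- The merged tau sequence: the indices `0` and `1` are collected into `τ_0 τ_1` at index `1`. -/
def merge {F : Type*} [Field F] (τ : ℕ → F) (i : ℕ) : F := if i = 1 then τ 0 * τ 1 else τ i

/-- Exchange of the entries `0` and `1`. -/
def swapFirst {F : Type*} (τ : ℕ → F) (i : ℕ) : F :=
  if i = 0 then τ 1 else if i = 1 then τ 0 else τ i

/-- Exchange of the entries `m + 1` and `m + 2`. -/
def swapLast {F : Type*} (m : ℕ) (τ : ℕ → F) (i : ℕ) : F :=
  if i = m + 1 then τ (m + 2) else if i = m + 2 then τ (m + 1) else τ i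

/-- The bilinear equations `⟨1,i⟩`, `⟨2,i⟩`, `⟨3,i⟩` for `n = m + 2`. -/
structure TauSystem {F : Type*} [Field F] (m : ℕ)
    (lam lamb kap kapb S W N E t0 t1 t2 t3 t4 : ℕ → F) (α β : F) : Prop where
  e10 : kapb 1 * N 1 * t4 1 - lamb 1 * E 1 * t2 1 = α * t0 0 * t1 0
  e11 : kap 1 * N 1 * t4 0 - lam 1 * E 1 * t2 0 = α * t0 1 * t1 1
  e1 : ∀ i, 1 ≤ i → i < m →
    kap (i + 1) * E i * N (i + 1) - lam (i + 1) * N i * E (i + 1) = α * t0 (i + 1) * t1 (i + 1)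
  e1p : kap (m + 1) * kap (m + 2) * E m * t2 (m + 2) - lam (m + 1) * lam (m + 2) * N m * t4 (m + 2)
    = α * t0 (m + 1) * t1 (m + 2)
  e1l : kap (m + 1) * E m * t2 (m + 1) - lam (m + 1) * N m * t4 (m + 1)
    = α * t0 (m + 2) * t1 (m + 1)
  e20 : kap 1 * N 1 * t3 1 + lamb 1 * W 1 * t1 1 = β * t0 0 * t2 0
  e21 : kapb 1 * N 1 * t3 0 + lam 1 * W 1 * t1 0 = β * t0 1 * t2 1
  e2 : ∀ i, 1 ≤ i → i < m →
    kapb (i + 1) * W i * N (i + 1) + lam (i + 1) * N i * W (i + 1) = β * t0 (i + 1) * t2 (i + 1)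
  e2p : kap (m + 2) * kapb (m + 1) * W m * t1 (m + 1) + lam (m + 1) * N m * t3 (m + 1)
    = β * t0 (m + 1) * t2 (m + 1)
  e2l : kapb (m + 1) * W m * t1 (m + 2) + lam (m + 1) * lam (m + 2) * N m * t3 (m + 2)
    = β * t0 (m + 2) * t2 (m + 2)
  e30 : kap 1 * S 1 * t2 1 - lam 1 * W 1 * t4 1 = α * t0 0 * t3 0
  e31 : kapb 1 * S 1 * t2 0 - lamb 1 * W 1 * t4 0 = α * t0 1 * t3 1
  e3 : ∀ i, 1 ≤ i → i < m →
    kapb (i + 1) * W i * S (i + 1) - lamb (i + 1) * S i * W (i + 1) = α * t0 (i + 1) * t3 (i + 1)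
  e3p : kapb (m + 1) * W m * t4 (m + 2) - lamb (m + 1) * S m * t2 (m + 2)
    = α * t0 (m + 1) * t3 (m + 2)
  e3l : kap (m + 2) * kapb (m + 1) * W m * t4 (m + 1)
      - lam (m + 2) * lamb (m + 1) * S m * t2 (m + 1) = α * t0 (m + 2) * t3 (m + 1)

/-- `(z, zb)` agrees with `[μ; τ, C, τ']` for `n = m + 2` on the meaningful indices, all the
parameters being nonzero. -/
structure IsBracket {F : Type*} [Field F] (m : ℕ) (μ μb τ C τ' z zb : ℕ → F) : Prop where
  two_le : 2 ≤ m
  mu_ne : ∀ i, 1 ≤ i → i ≤ m + 2 → μ i ≠ 0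
  mub_ne : ∀ i, 1 ≤ i → i ≤ m + 1 → μb i ≠ 0
  tau_ne : ∀ i ≤ m + 2, τ i ≠ 0
  tau'_ne : ∀ i ≤ m + 2, τ' i ≠ 0
  c_ne : ∀ i, 1 ≤ i → i ≤ m → C i ≠ 0
  first : z 1 = (μ 1)⁻¹ * (τ 0 * τ' 1 / C 1)
  firstb : zb 1 = (μb 1)⁻¹ * (τ 1 * τ' 0 / C 1)
  mid : ∀ i, 1 ≤ i → i < m →
    z (i + 1) = (μ (i + 1))⁻¹ * (C i * τ' (i + 1) / (C (i + 1) * merge τ' i))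
  midb : ∀ i, 1 ≤ i → i < m →
    zb (i + 1) = (μb (i + 1))⁻¹ * (C i * τ (i + 1) / (C (i + 1) * merge τ i))
  penult : z (m + 1) = (μ (m + 1))⁻¹ * (C m * τ' (m + 1) / (τ (m + 1) * τ' m))
  penultb : zb (m + 1) = (μb (m + 1))⁻¹ * (C m * τ (m + 2) / (τ m * τ' (m + 2)))
  last : z (m + 2) = (μ (m + 2))⁻¹ * (τ (m + 1) * τ' (m + 2) / (τ (m + 2) * τ' (m + 1)))

section Auxiliary

variable {F : Type*} [Field F] {m : ℕ}

lemma merge_one (τ : ℕ → F) : merge τ 1 = τ 0 * τ 1 := by simp [merge]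

lemma merge_of_two_le (τ : ℕ → F) {i : ℕ} (hi : 2 ≤ i) : merge τ i = τ i := by
  simp [merge, show i ≠ 1 by omega]

lemma merge_succ (τ : ℕ → F) {i : ℕ} (hi : 1 ≤ i) : merge τ (i + 1) = τ (i + 1) :=
  merge_of_two_le τ (by omega)

lemma merge_ne_zero {τ : ℕ → F} (h : ∀ i ≤ m + 2, τ i ≠ 0) {i : ℕ} (hi : i ≤ m + 2) :
    merge τ i ≠ 0 := by
  unfold merge
  split_ifs
  · exact mul_ne_zero (h 0 (by omega)) (h 1 (by omega))
  · exact h i hi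

lemma merge_swapFirst (τ : ℕ → F) {i : ℕ} (hi : 1 ≤ i) : merge (swapFirst τ) i = merge τ i := by
  by_cases h : i = 1
  · simp [h, merge, swapFirst, mul_comm]
  · simp [merge, swapFirst, h, show i ≠ 0 by omega]

lemma swapFirst_of_two_le {F : Type*} (τ : ℕ → F) {i : ℕ} (hi : 2 ≤ i) : swapFirst τ i = τ i := by
  simp [swapFirst, show i ≠ 0 by omega, show i ≠ 1 by omega]

lemma swapLast_of_le {F : Type*} (τ : ℕ → F) {i : ℕ} (hi : i ≤ m) : swapLast m τ i = τ i := by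
  simp [swapLast, show i ≠ m + 1 by omega, show i ≠ m + 2 by omega]

lemma swapLast_penult {F : Type*} (τ : ℕ → F) : swapLast m τ (m + 1) = τ (m + 2) := by
  simp [swapLast]

lemma swapLast_last {F : Type*} (τ : ℕ → F) : swapLast m τ (m + 2) = τ (m + 1) := by
  simp [swapLast]

lemma merge_swapLast (hm : 2 ≤ m) (τ : ℕ → F) {i : ℕ} (hi : i ≤ m) :
    merge (swapLast m τ) i = merge τ i := by
  unfold merge
  rw [swapLast_of_le _ hi, swapLast_of_le _ (by omega), swapLast_of_le _ (by omega)]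

lemma swapFirst_ne_zero {τ : ℕ → F} (h : ∀ i ≤ m + 2, τ i ≠ 0) :
    ∀ i ≤ m + 2, swapFirst τ i ≠ 0 := by
  intro i hi
  unfold swapFirst
  split_ifs <;> exact h _ (by omega)

lemma swapLast_ne_zero {τ : ℕ → F} (h : ∀ i ≤ m + 2, τ i ≠ 0) :
    ∀ i ≤ m + 2, swapLast m τ i ≠ 0 := by
  intro i hi
  unfold swapLast
  split_ifs <;> exact h _ (by omega)

lemma sw1_one {F : Type*} (x xb : ℕ → F) : sw1 x xb 1 = xb 1 := by simp [sw1]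

lemma sw1_of_two_le {F : Type*} (x xb : ℕ → F) {i : ℕ} (hi : 2 ≤ i) : sw1 x xb i = x i := by
  simp [sw1, show i ≠ 1 by omega]

lemma snx_of_le (x : ℕ → F) {i : ℕ} (hi : i ≤ m) : snx (m + 2) x i = x i := by
  simp [snx, show i ≠ m + 1 by omega, show i ≠ m + 2 by omega]

lemma snx_penult (x : ℕ → F) : snx (m + 2) x (m + 1) = x (m + 1) * x (m + 2) := by
  simp [snx]

lemma snx_last (x : ℕ → F) : snx (m + 2) x (m + 2) = (x (m + 2))⁻¹ := by
  simp [snx]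

lemma snxb_of_le (x xb : ℕ → F) {i : ℕ} (hi : i ≤ m) : snxb (m + 2) x xb i = xb i := by
  simp [snxb, show i ≠ m + 1 by omega]

lemma snxb_penult (x xb : ℕ → F) : snxb (m + 2) x xb (m + 1) = xb (m + 1) * x (m + 2) := by
  simp [snxb]

lemma stx_of_le {F : Type*} (x xb : ℕ → F) {i : ℕ} (hi : i ≤ m + 1) : stx (m + 2) x xb i = xb i := by
  simp [stx, show i ≠ m + 2 by omega]

lemma stx_last {F : Type*} (x xb : ℕ → F) : stx (m + 2) x xb (m + 2) = x (m + 2) := by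
  simp [stx]

section Level

lemma lev_add_two (x xb : ℕ → F) :
    lev (m + 2) x xb = (∏ i ∈ Finset.Icc 1 m, x i) * (∏ i ∈ Finset.Icc 1 m, xb i)
      * x (m + 1) * x (m + 2) * xb (m + 1) := by
  unfold lev
  rw [show m + 2 - 1 = m + 1 by omega, Finset.prod_Icc_succ_top (by omega),
    Finset.prod_Icc_succ_top (by omega), Finset.prod_Icc_succ_top (by omega)]
  ring

lemma prod_sw1 (x xb : ℕ → F) {r : ℕ} (hr : 1 ≤ r) :
    (∏ i ∈ Finset.Icc 1 r, sw1 x xb i) * (∏ i ∈ Finset.Icc 1 r, sw1 xb x i)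
      = (∏ i ∈ Finset.Icc 1 r, x i) * ∏ i ∈ Finset.Icc 1 r, xb i := by
  induction r, hr using Nat.le_induction with
  | base => simp [sw1_one, mul_comm]
  | succ r hr ih =>
    simp only [Finset.prod_Icc_succ_top (show 1 ≤ r + 1 by omega)]
    rw [sw1_of_two_le _ _ (by omega), sw1_of_two_le _ _ (by omega)]
    linear_combination x (r + 1) * xb (r + 1) * ih

lemma lev_sw1 (hm : 2 ≤ m) (x xb : ℕ → F) :
    lev (m + 2) (sw1 x xb) (sw1 xb x) = lev (m + 2) x xb := by
  rw [lev_add_two, lev_add_two, prod_sw1 _ _ (by omega), sw1_of_two_le _ _ (by omega),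
    sw1_of_two_le _ _ (by omega), sw1_of_two_le _ _ (by omega)]

lemma lev_snx (x xb : ℕ → F) (hx : x (m + 2) ≠ 0) :
    lev (m + 2) (snx (m + 2) x) (snxb (m + 2) x xb) = lev (m + 2) x xb := by
  have h : ∀ i ∈ Finset.Icc 1 m, snx (m + 2) x i = x i := fun i hi =>
    snx_of_le x (Finset.mem_Icc.mp hi).2
  have h' : ∀ i ∈ Finset.Icc 1 m, snxb (m + 2) x xb i = xb i := fun i hi =>
    snxb_of_le x xb (Finset.mem_Icc.mp hi).2
  rw [lev_add_two, lev_add_two, Finset.prod_congr rfl h, Finset.prod_congr rfl h', snx_penult,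
    snx_last, snxb_penult]
  field_simp

lemma lev_stx (x xb : ℕ → F) : lev (m + 2) (stx (m + 2) x xb) x = lev (m + 2) x xb := by
  have h : ∀ i ∈ Finset.Icc 1 m, stx (m + 2) x xb i = xb i := fun i hi =>
    stx_of_le x xb ((Finset.mem_Icc.mp hi).2.trans (by omega))
  rw [lev_add_two, lev_add_two, Finset.prod_congr rfl h, stx_of_le _ _ le_rfl, stx_last]
  ring

end Level

namespace IsBracket

variable {μ μb τ C τ' z zb : ℕ → F}

lemma merge_tau_ne (h : IsBracket m μ μb τ C τ' z zb) {i : ℕ} (hi : i ≤ m + 2) :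
    merge τ i ≠ 0 := merge_ne_zero h.tau_ne hi

lemma merge_tau'_ne (h : IsBracket m μ μb τ C τ' z zb) {i : ℕ} (hi : i ≤ m + 2) :
    merge τ' i ≠ 0 := merge_ne_zero h.tau'_ne hi

lemma sigma_one (h : IsBracket m μ μb τ C τ' z zb) :
    IsBracket m (sw1 μ μb) (sw1 μb μ) (swapFirst τ) C (swapFirst τ') (sw1 z zb) (sw1 zb z) where
  two_le := h.two_le
  mu_ne i h1 h2 := by
    unfold sw1
    split_ifs
    exacts [h.mub_ne 1 le_rfl (by omega), h.mu_ne i h1 h2]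
  mub_ne i h1 h2 := by
    unfold sw1
    split_ifs
    exacts [h.mu_ne 1 le_rfl (by omega), h.mub_ne i h1 h2]
  tau_ne := swapFirst_ne_zero h.tau_ne
  tau'_ne := swapFirst_ne_zero h.tau'_ne
  c_ne := h.c_ne
  first := by simp [sw1_one, swapFirst, h.firstb]
  firstb := by simp [sw1_one, swapFirst, h.first]
  mid i h1 h2 := by
    rw [sw1_of_two_le _ _ (by omega), sw1_of_two_le _ _ (by omega), merge_swapFirst _ h1,
      swapFirst_of_two_le _ (by omega), h.mid i h1 h2]
  midb i h1 h2 := by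
    rw [sw1_of_two_le _ _ (by omega), sw1_of_two_le _ _ (by omega), merge_swapFirst _ h1,
      swapFirst_of_two_le _ (by omega), h.midb i h1 h2]
  penult := by
    have := h.two_le
    simp only [sw1_of_two_le _ _ (show 2 ≤ m + 1 by omega), swapFirst_of_two_le _ this,
      swapFirst_of_two_le _ (show 2 ≤ m + 1 by omega), h.penult]
  penultb := by
    have := h.two_le
    simp only [sw1_of_two_le _ _ (show 2 ≤ m + 1 by omega), swapFirst_of_two_le _ this,
      swapFirst_of_two_le _ (show 2 ≤ m + 2 by omega), h.penultb]
  last := by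
    have := h.two_le
    simp only [sw1_of_two_le _ _ (show 2 ≤ m + 2 by omega),
      swapFirst_of_two_le _ (show 2 ≤ m + 1 by omega),
      swapFirst_of_two_le _ (show 2 ≤ m + 2 by omega), h.last]

lemma sigma_last (h : IsBracket m μ μb τ C τ' z zb) :
    IsBracket m (snx (m + 2) μ) (snxb (m + 2) μ μb) (swapLast m τ) C (swapLast m τ')
      (snx (m + 2) z) (snxb (m + 2) z zb) where
  two_le := h.two_le
  mu_ne i h1 h2 := by
    have := h.mu_ne (m + 2) (by omega) le_rfl
    unfold snx
    split_ifs
    exacts [mul_ne_zero (h.mu_ne (m + 1) (by omega) (by omega)) this, inv_ne_zero this,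
      h.mu_ne i h1 h2]
  mub_ne i h1 h2 := by
    unfold snxb
    split_ifs
    exacts [mul_ne_zero (h.mub_ne (m + 1) (by omega) le_rfl)
      (h.mu_ne (m + 2) (by omega) le_rfl), h.mub_ne i h1 h2]
  tau_ne := swapLast_ne_zero h.tau_ne
  tau'_ne := swapLast_ne_zero h.tau'_ne
  c_ne := h.c_ne
  first := by
    have := h.two_le
    rw [snx_of_le _ (by omega), snx_of_le _ (by omega), swapLast_of_le _ (by omega),
      swapLast_of_le _ (by omega), h.first]
  firstb := by
    have := h.two_le
    rw [snxb_of_le _ _ (by omega), snxb_of_le _ _ (by omega), swapLast_of_le _ (by omega),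
      swapLast_of_le _ (by omega), h.firstb]
  mid i h1 h2 := by
    rw [snx_of_le _ (by omega), snx_of_le _ (by omega), merge_swapLast h.two_le _ h2.le,
      swapLast_of_le _ (by omega), h.mid i h1 h2]
  midb i h1 h2 := by
    rw [snxb_of_le _ _ (by omega), snxb_of_le _ _ (by omega), merge_swapLast h.two_le _ h2.le,
      swapLast_of_le _ (by omega), h.midb i h1 h2]
  penult := by
    have h1 := h.tau_ne (m + 1) (by omega)
    have h2 := h.tau'_ne (m + 1) (by omega)
    rw [snx_penult, snx_penult, swapLast_penult, swapLast_penult, swapLast_of_le _ le_rfl,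
      h.penult, h.last]
    field_simp
  penultb := by
    have h1 := h.tau_ne (m + 2) (by omega)
    have h2 := h.tau'_ne (m + 2) (by omega)
    rw [snxb_penult, snxb_penult, swapLast_last, swapLast_last, swapLast_of_le _ le_rfl,
      h.penultb, h.last]
    field_simp
  last := by
    simp only [snx_last, swapLast_last, swapLast_penult, h.last]
    field_simp

lemma star (h : IsBracket m μ μb τ C τ' z zb) :
    IsBracket m (stx (m + 2) μ μb) μ (swapLast m τ') C (swapLast m τ) (stx (m + 2) z zb) z where
  two_le := h.two_le
  mu_ne i h1 h2 := by
    unfold stx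
    split_ifs
    exacts [h.mu_ne (m + 2) (by omega) le_rfl, h.mub_ne i h1 (by omega)]
  mub_ne i h1 h2 := h.mu_ne i h1 (by omega)
  tau_ne := swapLast_ne_zero h.tau'_ne
  tau'_ne := swapLast_ne_zero h.tau_ne
  c_ne := h.c_ne
  first := by
    have := h.two_le
    rw [stx_of_le _ _ (by omega), stx_of_le _ _ (by omega), swapLast_of_le _ (by omega),
      swapLast_of_le _ (by omega), h.firstb, mul_comm (τ 1)]
  firstb := by
    have := h.two_le
    rw [swapLast_of_le _ (by omega), swapLast_of_le _ (by omega), h.first, mul_comm (τ 0)]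
  mid i h1 h2 := by
    rw [stx_of_le _ _ (by omega), stx_of_le _ _ (by omega), merge_swapLast h.two_le _ h2.le,
      swapLast_of_le _ (by omega), h.midb i h1 h2]
  midb i h1 h2 := by
    rw [merge_swapLast h.two_le _ h2.le, swapLast_of_le _ (by omega), h.mid i h1 h2]
  penult := by
    rw [stx_of_le _ _ le_rfl, stx_of_le _ _ le_rfl, swapLast_penult, swapLast_penult,
      swapLast_of_le _ le_rfl, h.penultb, mul_comm (τ m)]
  penultb := by
    rw [swapLast_last, swapLast_last, swapLast_of_le _ le_rfl, h.penult, mul_comm (τ (m + 1))]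
  last := by
    rw [stx_last, stx_last, swapLast_last, swapLast_last, swapLast_penult, swapLast_penult, h.last]
    ring

lemma prod_eq (h : IsBracket m μ μb τ C τ' z zb) {r : ℕ} (hr : 1 ≤ r) (hrm : r ≤ m) :
    ∏ i ∈ Finset.Icc 1 r, z i
      = (∏ i ∈ Finset.Icc 1 r, μ i)⁻¹ * (merge τ' r * τ 0 / (C r * τ' 0)) := by
  induction r, hr using Nat.le_induction with
  | base =>
    have h0 := h.tau'_ne 0 (by omega)
    simp only [Finset.Icc_self, Finset.prod_singleton, merge_one, h.first]
    field_simp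
  | succ r hr ih =>
    have h1 := h.merge_tau'_ne (show r ≤ m + 2 by omega)
    have h2 := h.c_ne r hr (by omega)
    rw [Finset.prod_Icc_succ_top (by omega), Finset.prod_Icc_succ_top (by omega), ih (by omega),
      h.mid r hr hrm, merge_succ _ hr]
    field_simp

lemma prodb_eq (h : IsBracket m μ μb τ C τ' z zb) {r : ℕ} (hr : 1 ≤ r) (hrm : r ≤ m) :
    ∏ i ∈ Finset.Icc 1 r, zb i
      = (∏ i ∈ Finset.Icc 1 r, μb i)⁻¹ * (merge τ r * τ' 0 / (C r * τ 0)) := by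
  induction r, hr using Nat.le_induction with
  | base =>
    have h0 := h.tau_ne 0 (by omega)
    simp only [Finset.Icc_self, Finset.prod_singleton, merge_one, h.firstb]
    field_simp
  | succ r hr ih =>
    have h1 := h.merge_tau_ne (show r ≤ m + 2 by omega)
    have h2 := h.c_ne r hr (by omega)
    rw [Finset.prod_Icc_succ_top (by omega), Finset.prod_Icc_succ_top (by omega), ih (by omega),
      h.midb r hr hrm, merge_succ _ hr]
    field_simp

lemma lev_eq (h : IsBracket m μ μb τ C τ' z zb) :
    lev (m + 2) z zb = (lev (m + 2) μ μb)⁻¹ := by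
  have hm := h.two_le
  rw [lev_add_two, lev_add_two, h.prod_eq (by omega) le_rfl, h.prodb_eq (by omega) le_rfl,
    h.penult, h.penultb, h.last, merge_of_two_le _ hm, merge_of_two_le _ hm]
  have a0 := h.tau_ne 0 (by omega)
  have a1 := h.tau'_ne 0 (by omega)
  have a2 := h.tau_ne m (by omega)
  have a3 := h.tau'_ne m (by omega)
  have a4 := h.tau_ne (m + 1) (by omega)
  have a5 := h.tau'_ne (m + 1) (by omega)
  have a6 := h.tau_ne (m + 2) (by omega)
  have a7 := h.tau'_ne (m + 2) (by omega)
  have a8 := h.c_ne m (by omega) le_rfl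
  field_simp

end IsBracket

namespace TauSystem

variable {lam lamb kap kapb S W N E t0 t1 t2 t3 t4 x xb y yb : ℕ → F} {α β : F}

lemma sigma_one (h : TauSystem m lam lamb kap kapb S W N E t0 t1 t2 t3 t4 α β) (hm : 2 ≤ m) :
    TauSystem m (sw1 lam lamb) (sw1 lamb lam) (sw1 kap kapb) (sw1 kapb kap) S W N E
      (swapFirst t0) (swapFirst t1) (swapFirst t2) (swapFirst t3) (swapFirst t4) α β := by
  have a : 2 ≤ m + 1 := by omega
  have b : 2 ≤ m + 2 := by omega
  have s0 : ∀ τ : ℕ → F, swapFirst τ 0 = τ 1 := fun τ => by simp [swapFirst]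
  have s1 : ∀ τ : ℕ → F, swapFirst τ 1 = τ 0 := fun τ => by simp [swapFirst]
  constructor
  case e1 | e2 | e3 =>
    intro i h1 h2
    have c : 2 ≤ i + 1 := by omega
    simp only [sw1_of_two_le _ _ c, swapFirst_of_two_le _ c]
    first | exact h.e1 i h1 h2 | exact h.e2 i h1 h2 | exact h.e3 i h1 h2
  all_goals
    simp only [sw1_one, s0, s1, sw1_of_two_le _ _ a, sw1_of_two_le _ _ b,
      swapFirst_of_two_le _ a, swapFirst_of_two_le _ b]
  exacts [h.e11, h.e10, h.e1p, h.e1l, h.e21, h.e20, h.e2p, h.e2l, h.e31, h.e30, h.e3p, h.e3l]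

lemma sigma_last (h : TauSystem m lam lamb kap kapb S W N E t0 t1 t2 t3 t4 α β) (hm : 2 ≤ m)
    (hlam : lam (m + 2) ≠ 0) (hkap : kap (m + 2) ≠ 0) :
    TauSystem m (snx (m + 2) lam) (snxb (m + 2) lam lamb) (snx (m + 2) kap)
      (snxb (m + 2) kap kapb) S W N E (swapLast m t0) (swapLast m t1) (swapLast m t2)
      (swapLast m t3) (swapLast m t4) α β := by
  have a : 1 ≤ m := by omega
  constructor
  case e1 | e2 | e3 =>
    intro i h1 h2
    have c : i + 1 ≤ m := h2
    simp only [snx_of_le _ c, snxb_of_le _ _ c, swapLast_of_le _ c]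
    first | exact h.e1 i h1 h2 | exact h.e2 i h1 h2 | exact h.e3 i h1 h2
  all_goals
    simp only [snx_of_le _ a, snxb_of_le _ _ a, swapLast_of_le _ a, swapLast_of_le _ m.zero_le,
      snx_penult, snx_last, snxb_penult, swapLast_penult, swapLast_last]
  · exact h.e10
  · exact h.e11
  · rw [← h.e1l]
    field_simp
  · exact h.e1p
  · exact h.e20
  · exact h.e21
  · rw [← h.e2l]
    field_simp
  · rw [← h.e2p]
    field_simp
  · exact h.e30
  · exact h.e31
  · rw [← h.e3l]
    ring
  · rw [← h.e3p]
    field_simp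

lemma star (h : TauSystem m lam lamb kap kapb S W N E t0 t1 t2 t3 t4 α β) (hm : 2 ≤ m) :
    TauSystem m (stx (m + 2) kap kapb) kap (stx (m + 2) lam lamb) lam E N W S
      (swapLast m t0) (swapLast m t3) (swapLast m t2) (swapLast m t1) (swapLast m t4) (-α) β := by
  have a : 1 ≤ m := by omega
  have a' : 1 ≤ m + 1 := by omega
  constructor
  case e1 | e2 | e3 =>
    intro i h1 h2
    have c : i + 1 ≤ m := h2
    have c' : i + 1 ≤ m + 1 := by omega
    simp only [stx_of_le _ _ c', swapLast_of_le _ c]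
    first
      | linear_combination - h.e3 i h1 h2 | linear_combination h.e2 i h1 h2
      | linear_combination - h.e1 i h1 h2
  all_goals
    simp only [stx_of_le _ _ a', swapLast_of_le _ a, swapLast_of_le _ m.zero_le,
      stx_of_le _ _ le_rfl, stx_last, swapLast_penult, swapLast_last]
  · linear_combination - h.e30
  · linear_combination - h.e31
  · linear_combination - h.e3l
  · linear_combination - h.e3p
  · linear_combination h.e20
  · linear_combination h.e21
  · linear_combination h.e2l
  · linear_combination h.e2p
  · linear_combination - h.e10
  · linear_combination - h.e11
  · linear_combination - h.e1l
  · linear_combination - h.e1p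

lemma inv_add_inv_first (h : TauSystem m lam lamb kap kapb S W N E t0 t1 t2 t3 t4 α β)
    (hx : IsBracket m lam lamb t3 W t2 x xb) (hy : IsBracket m kap kapb t2 N t1 y yb) :
    1 / x 1 + 1 / yb 1 = β * t0 1 / (t3 0 * t1 0) := by
  have hm := hx.two_le
  have a0 := hx.mu_ne 1 le_rfl (by omega)
  have a1 := hy.mub_ne 1 le_rfl (by omega)
  have a2 := hx.tau_ne 0 (by omega)
  have a3 := hy.tau'_ne 0 (by omega)
  have a4 := hx.tau'_ne 1 (by omega)
  have a5 := hx.c_ne 1 le_rfl (by omega)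
  have a6 := hy.c_ne 1 le_rfl (by omega)
  rw [hx.first, hy.firstb]
  field_simp
  linear_combination h.e21

lemma inv_add_inv_mid (h : TauSystem m lam lamb kap kapb S W N E t0 t1 t2 t3 t4 α β)
    (hx : IsBracket m lam lamb t3 W t2 x xb) (hy : IsBracket m kap kapb t2 N t1 y yb)
    {i : ℕ} (hi : 1 ≤ i) (him : i < m) :
    1 / x (i + 1) + 1 / yb (i + 1) = β * t0 (i + 1) * merge t2 i / (W i * N i) := by
  have a0 := hx.mu_ne (i + 1) (by omega) (by omega)
  have a1 := hy.mub_ne (i + 1) (by omega) (by omega)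
  have a2 := hx.c_ne i hi him.le
  have a3 := hy.c_ne i hi him.le
  have a4 := hx.c_ne (i + 1) (by omega) him
  have a5 := hy.c_ne (i + 1) (by omega) him
  have a6 := hx.tau'_ne (i + 1) (by omega)
  have a7 := hx.merge_tau'_ne (show i ≤ m + 2 by omega)
  rw [hx.mid i hi him, hy.midb i hi him]
  field_simp
  linear_combination h.e2 i hi him

lemma inv_add_inv_penult (h : TauSystem m lam lamb kap kapb S W N E t0 t1 t2 t3 t4 α β)
    (hx : IsBracket m lam lamb t3 W t2 x xb) (hy : IsBracket m kap kapb t2 N t1 y yb) :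
    y (m + 2) / x (m + 1) + 1 / yb (m + 1)
      = y (m + 2) * (β * t0 (m + 1) * t2 m / (W m * N m)) := by
  have hm := hx.two_le
  have a0 := hx.mu_ne (m + 1) (by omega) (by omega)
  have a1 := hy.mub_ne (m + 1) (by omega) (by omega)
  have a1' := hy.mu_ne (m + 2) (by omega) (by omega)
  have a2 := hx.c_ne m (by omega) le_rfl
  have a3 := hy.c_ne m (by omega) le_rfl
  have a4 := hx.tau'_ne m (by omega)
  have a5 := hx.tau'_ne (m + 1) (by omega)
  have a6 := hx.tau'_ne (m + 2) (by omega)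
  have a7 := hx.tau_ne (m + 1) (by omega)
  have a8 := hy.tau'_ne (m + 1) (by omega)
  have a9 := hy.tau'_ne (m + 2) (by omega)
  rw [hx.penult, hy.penultb, hy.last]
  field_simp
  linear_combination h.e2p

lemma partial_sum_eq (h : TauSystem m lam lamb kap kapb S W N E t0 t1 t2 t3 t4 α β) (hα : α ≠ 0)
    (hx : IsBracket m lam lamb t3 W t2 x xb) (hy : IsBracket m kap kapb t2 N t1 y yb)
    {r : ℕ} (hr : 1 ≤ r) (hrm : r ≤ m) :
    y 1 / yb 1 + ∑ j ∈ Finset.Icc 2 r, (∏ i ∈ Finset.Icc 1 (j - 1), y i / x i) * (1 + y j / yb j)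
        + ∏ i ∈ Finset.Icc 1 r, y i / x i
      = β / α * (t2 0 / (t3 0 * t1 0)) * (t4 0 - t2 0
        * ((∏ i ∈ Finset.Icc 1 r, lam i) / ∏ i ∈ Finset.Icc 1 r, kap i) * (E r / N r)) := by
  have hm := hx.two_le
  induction r, hr using Nat.le_induction with
  | base =>
    have a0 := hy.mu_ne 1 le_rfl (by omega)
    have a1 := hx.tau_ne 0 (by omega)
    have a2 := hy.tau'_ne 0 (by omega)
    have a3 := hy.c_ne 1 le_rfl (by omega)
    have e : y 1 / yb 1 + y 1 / x 1 = y 1 * (1 / x 1 + 1 / yb 1) := by ring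
    simp only [Finset.Icc_self, Finset.prod_singleton, Finset.Icc_eq_empty (show ¬ 2 ≤ 1 by omega),
      Finset.sum_empty, add_zero]
    rw [e, h.inv_add_inv_first hx hy, hy.first]
    field_simp
    linear_combination - t2 0 * β * h.e11
  | succ r hr ih =>
    have ih := ih (by omega)
    have key : (∏ i ∈ Finset.Icc 1 (r + 1), y i / x i)
          * (x (r + 1) * (1 / x (r + 1) + 1 / yb (r + 1)))
        = β / α * (t2 0 / (t3 0 * t1 0)) * (t2 0
          * ((∏ i ∈ Finset.Icc 1 r, lam i) / ∏ i ∈ Finset.Icc 1 r, kap i) * (E r / N r)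
          - t2 0 * ((∏ i ∈ Finset.Icc 1 (r + 1), lam i) / ∏ i ∈ Finset.Icc 1 (r + 1), kap i)
            * (E (r + 1) / N (r + 1))) := by
      have a0 := hy.mu_ne (r + 1) (by omega) (by omega)
      have a0' := hx.mu_ne (r + 1) (by omega) (by omega)
      have a1 := hx.tau_ne 0 (by omega)
      have a2 := hy.tau'_ne 0 (by omega)
      have a2' := hy.tau_ne 0 (by omega)
      have a3 := hy.c_ne r hr (by omega)
      have a4 := hx.c_ne r hr (by omega)
      have a3' := hy.c_ne (r + 1) (by omega) hrm
      have a4' := hx.c_ne (r + 1) (by omega) hrm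
      have a5 := hx.merge_tau'_ne (show r ≤ m + 2 by omega)
      have a5' := hx.tau'_ne (r + 1) (show r + 1 ≤ m + 2 by omega)
      have b : ∏ i ∈ Finset.Icc 1 r, lam i ≠ 0 := Finset.prod_ne_zero_iff.mpr fun i hi =>
        hx.mu_ne i (Finset.mem_Icc.mp hi).1 (by have := (Finset.mem_Icc.mp hi).2; omega)
      have b' : ∏ i ∈ Finset.Icc 1 r, kap i ≠ 0 := Finset.prod_ne_zero_iff.mpr fun i hi =>
        hy.mu_ne i (Finset.mem_Icc.mp hi).1 (by have := (Finset.mem_Icc.mp hi).2; omega)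
      rw [Finset.prod_div_distrib, hx.prod_eq (by omega) hrm, hy.prod_eq (by omega) hrm,
        h.inv_add_inv_mid hx hy hr hrm, hx.mid r hr hrm, merge_succ _ hr, merge_succ _ hr,
        Finset.prod_Icc_succ_top (by omega), Finset.prod_Icc_succ_top (by omega)]
      field_simp
      linear_combination - β * h.e1 r hr hrm
    have hxne : x (r + 1) ≠ 0 := by
      have a0 := hx.mu_ne (r + 1) (by omega) (by omega)
      have a4 := hx.c_ne r hr (by omega)
      have a4' := hx.c_ne (r + 1) (by omega) hrm
      have a5 := hx.merge_tau'_ne (show r ≤ m + 2 by omega)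
      have a5' := hx.tau'_ne (r + 1) (show r + 1 ≤ m + 2 by omega)
      rw [hx.mid r hr hrm]
      positivity
    have e : (∏ i ∈ Finset.Icc 1 r, y i / x i) * (y (r + 1) / yb (r + 1))
        = (∏ i ∈ Finset.Icc 1 (r + 1), y i / x i) * (x (r + 1) * (1 / yb (r + 1))) := by
      rw [Finset.prod_Icc_succ_top (by omega)]
      field_simp
    have e' : x (r + 1) * (1 / x (r + 1)) = 1 := by field_simp
    rw [Finset.sum_Icc_succ_top (by omega), Nat.add_sub_cancel]
    linear_combination ih + key + e - (∏ i ∈ Finset.Icc 1 (r + 1), y i / x i) * e'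

/-- The `σ✶`-image of `partial_sum_eq`. -/
lemma partial_sum_star_eq (h : TauSystem m lam lamb kap kapb S W N E t0 t1 t2 t3 t4 α β)
    (hα : α ≠ 0) (hx : IsBracket m lam lamb t3 W t2 x xb)
    (hy : IsBracket m kap kapb t2 N t1 y yb) :
    xb 1 / x 1 + ∑ j ∈ Finset.Icc 2 m, (∏ i ∈ Finset.Icc 1 (j - 1), xb i / yb i) * (1 + xb j / x j)
        + ∏ i ∈ Finset.Icc 1 m, xb i / yb i
      = -(β / α * (t2 0 / (t3 0 * t1 0)) * (t4 0 - t2 0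
        * ((∏ i ∈ Finset.Icc 1 m, kapb i) / ∏ i ∈ Finset.Icc 1 m, lamb i) * (S m / W m))) := by
  have hm := hx.two_le
  have key := (h.star hm).partial_sum_eq (neg_ne_zero.mpr hα) hy.star hx.star
    (show 1 ≤ m by omega) le_rfl
  have hprod : ∀ r ≤ m, ∏ i ∈ Finset.Icc 1 r, stx (m + 2) x xb i / stx (m + 2) y yb i
      = ∏ i ∈ Finset.Icc 1 r, xb i / yb i := fun r hr => Finset.prod_congr rfl fun i hi => by
    have := (Finset.mem_Icc.mp hi).2
    rw [stx_of_le _ _ (by omega), stx_of_le _ _ (by omega)]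
  have hsum : ∑ j ∈ Finset.Icc 2 m,
        (∏ i ∈ Finset.Icc 1 (j - 1), stx (m + 2) x xb i / stx (m + 2) y yb i)
          * (1 + stx (m + 2) x xb j / x j)
      = ∑ j ∈ Finset.Icc 2 m, (∏ i ∈ Finset.Icc 1 (j - 1), xb i / yb i) * (1 + xb j / x j) :=
    Finset.sum_congr rfl fun j hj => by
      have := (Finset.mem_Icc.mp hj).2
      rw [hprod _ (by omega), stx_of_le _ _ (by omega)]
  have hmu : ∀ μ μb : ℕ → F, ∏ i ∈ Finset.Icc 1 m, stx (m + 2) μ μb i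
      = ∏ i ∈ Finset.Icc 1 m, μb i := fun μ μb => Finset.prod_congr rfl fun i hi => by
    have := (Finset.mem_Icc.mp hi).2
    rw [stx_of_le _ _ (by omega)]
  rw [hprod m le_rfl, hsum, hmu, stx_of_le _ _ (by omega), swapLast_of_le _ (Nat.zero_le _),
    swapLast_of_le _ (Nat.zero_le _), swapLast_of_le _ (Nat.zero_le _),
    swapLast_of_le _ (Nat.zero_le _), div_neg, mul_comm (t1 0)] at key
  rw [key, Finset.prod_congr rfl fun i hi =>
    (stx_of_le lam lamb (m := m) ((Finset.mem_Icc.mp hi).2.trans (by omega))).symm]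
  ring

/-- The quadratic relation at the end node that follows from the bilinear equations. -/
lemma end_relation (h : TauSystem m lam lamb kap kapb S W N E t0 t1 t2 t3 t4 α β)
    (ht2 : t2 (m + 2) ≠ 0) :
    kap (m + 1) * kap (m + 2) * kapb (m + 1) * E m * W m
        - lam (m + 1) * lam (m + 2) * lamb (m + 1) * N m * S m
      = α * β * t0 (m + 1) * t0 (m + 2) := by
  apply mul_left_cancel₀ ht2
  linear_combination kapb (m + 1) * W m * h.e1p + lam (m + 1) * lam (m + 2) * N m * h.e3p
    + α * t0 (m + 1) * h.e2l

lemma boundary_eq (h : TauSystem m lam lamb kap kapb S W N E t0 t1 t2 t3 t4 α β) (hα : α ≠ 0)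
    (hx : IsBracket m lam lamb t3 W t2 x xb) (hy : IsBracket m kap kapb t2 N t1 y yb) :
    lev (m + 2) x xb * ((∏ i ∈ Finset.Icc 1 m, y i / x i) * (y (m + 1) / yb (m + 1)))
      + x (m + 2) * y (m + 2) * ((∏ i ∈ Finset.Icc 1 m, xb i * y i) * (xb (m + 1) * y (m + 1)))
      + lev (m + 2) y yb * ((∏ i ∈ Finset.Icc 1 m, xb i / yb i) * (xb (m + 1) / x (m + 1)))
      + (∏ i ∈ Finset.Icc 1 m, xb i * y i) * (xb (m + 1) * y (m + 1))
    = β / α * (t2 0 / (t3 0 * t1 0)) * t2 0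
      * (lev (m + 2) x xb
          * ((∏ i ∈ Finset.Icc 1 m, lam i) / ∏ i ∈ Finset.Icc 1 m, kap i) * (E m / N m)
        - lev (m + 2) y yb
          * ((∏ i ∈ Finset.Icc 1 m, kapb i) / ∏ i ∈ Finset.Icc 1 m, lamb i) * (S m / W m)) := by
  have hm := hx.two_le
  have hm1 : 1 ≤ m := by omega
  have l1 := hx.mu_ne (m + 1) (by omega) (by omega)
  have l2 := hx.mu_ne (m + 2) (by omega) (by omega)
  have l3 := hx.mub_ne (m + 1) (by omega) (by omega)
  have k1 := hy.mu_ne (m + 1) (by omega) (by omega)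
  have k2 := hy.mu_ne (m + 2) (by omega) (by omega)
  have k3 := hy.mub_ne (m + 1) (by omega) (by omega)
  have c1 := hx.c_ne m hm1 le_rfl
  have c2 := hy.c_ne m hm1 le_rfl
  have a0 := hx.tau_ne 0 (by omega)
  have a1 := hx.tau'_ne 0 (by omega)
  have a2 := hy.tau'_ne 0 (by omega)
  have b0 := hx.tau_ne m (by omega)
  have b1 := hx.tau'_ne m (by omega)
  have b2 := hy.tau'_ne m (by omega)
  have d0 := hx.tau_ne (m + 1) (by omega)
  have d1 := hx.tau'_ne (m + 1) (by omega)
  have d2 := hy.tau'_ne (m + 1) (by omega)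
  have f0 := hx.tau_ne (m + 2) (by omega)
  have f1 := hx.tau'_ne (m + 2) (by omega)
  have f2 := hy.tau'_ne (m + 2) (by omega)
  have p1 : ∏ i ∈ Finset.Icc 1 m, lam i ≠ 0 := Finset.prod_ne_zero_iff.mpr fun i hi =>
    hx.mu_ne i (Finset.mem_Icc.mp hi).1 (by have := (Finset.mem_Icc.mp hi).2; omega)
  have p2 : ∏ i ∈ Finset.Icc 1 m, lamb i ≠ 0 := Finset.prod_ne_zero_iff.mpr fun i hi =>
    hx.mub_ne i (Finset.mem_Icc.mp hi).1 (by have := (Finset.mem_Icc.mp hi).2; omega)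
  have p3 : ∏ i ∈ Finset.Icc 1 m, kap i ≠ 0 := Finset.prod_ne_zero_iff.mpr fun i hi =>
    hy.mu_ne i (Finset.mem_Icc.mp hi).1 (by have := (Finset.mem_Icc.mp hi).2; omega)
  have p4 : ∏ i ∈ Finset.Icc 1 m, kapb i ≠ 0 := Finset.prod_ne_zero_iff.mpr fun i hi =>
    hy.mub_ne i (Finset.mem_Icc.mp hi).1 (by have := (Finset.mem_Icc.mp hi).2; omega)
  have rel := h.end_relation f1
  have e2p := h.e2p
  have e2l := h.e2l
  rw [hx.lev_eq, hy.lev_eq, lev_add_two, lev_add_two]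
  simp only [Finset.prod_div_distrib, Finset.prod_mul_distrib]
  rw [hx.prod_eq hm1 le_rfl, hx.prodb_eq hm1 le_rfl, hy.prod_eq hm1 le_rfl,
    hy.prodb_eq hm1 le_rfl, hx.penult, hx.penultb, hx.last, hy.penult, hy.penultb, hy.last]
  simp only [merge_of_two_le _ hm]
  generalize (∏ i ∈ Finset.Icc 1 m, lam i) = Λ at *
  generalize (∏ i ∈ Finset.Icc 1 m, lamb i) = Λb at *
  generalize (∏ i ∈ Finset.Icc 1 m, kap i) = K at *
  generalize (∏ i ∈ Finset.Icc 1 m, kapb i) = Kb at *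
  trans t2 0 ^ 2 / (t3 0 * t1 0) / (Λb * K * W m * N m)
      / (lam (m + 1) * lam (m + 2) * lamb (m + 1) * kap (m + 1) * kap (m + 2) * kapb (m + 1))
      / (t2 (m + 1) * t2 (m + 2))
      * ((kap (m + 2) * kapb (m + 1) * W m * t1 (m + 1) + lam (m + 1) * N m * t3 (m + 1))
      * (kapb (m + 1) * W m * t1 (m + 2) + lam (m + 1) * lam (m + 2) * N m * t3 (m + 2)))
  · field_simp
    ring
  rw [e2p, e2l]
  trans β / α * (t2 0 / (t3 0 * t1 0)) * t2 0 / (Λb * K * W m * N m)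
      / (lam (m + 1) * lam (m + 2) * lamb (m + 1) * kap (m + 1) * kap (m + 2) * kapb (m + 1))
      * (kap (m + 1) * kap (m + 2) * kapb (m + 1) * E m * W m
        - lam (m + 1) * lam (m + 2) * lamb (m + 1) * N m * S m)
  · rw [rel]
    field_simp
  · field_simp

lemma Vf_zero (h : TauSystem m lam lamb kap kapb S W N E t0 t1 t2 t3 t4 α β) (hα : α ≠ 0)
    (hx : IsBracket m lam lamb t3 W t2 x xb) (hy : IsBracket m kap kapb t2 N t1 y yb) :
    Vf (m + 2) x xb y yb 0
      = β / α * ((lev (m + 2) lam lamb)⁻¹ - (lev (m + 2) kap kapb)⁻¹)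
        * (t4 0 * t2 0 / (t3 0 * t1 0)) := by
  have hm := hx.two_le
  have s1 := h.partial_sum_eq hα hx hy (show 1 ≤ m by omega) le_rfl
  have s2 := h.partial_sum_star_eq hα hx hy
  have s3 := h.boundary_eq hα hx hy
  rw [← hx.lev_eq, ← hy.lev_eq]
  simp only [Vf, show m + 2 - 1 = m + 1 by omega, Finset.sum_Icc_succ_top (show 2 ≤ m + 1 by omega),
    Finset.prod_Icc_succ_top (show 1 ≤ m + 1 by omega), Nat.add_sub_cancel]
  linear_combination lev (m + 2) x xb * s1 + lev (m + 2) y yb * s2 + s3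

lemma Vf_mid (h : TauSystem m lam lamb kap kapb S W N E t0 t1 t2 t3 t4 α β) (hα : α ≠ 0)
    (hx : IsBracket m lam lamb t3 W t2 x xb) (hy : IsBracket m kap kapb t2 N t1 y yb)
    {i : ℕ} (hi : 1 ≤ i) (him : i ≤ m) :
    Vf (m + 2) x xb y yb i
      = β / α * ((lev (m + 2) lam lamb)⁻¹ - (lev (m + 2) kap kapb)⁻¹)
        * (S i * merge t2 i / (merge t3 i * N i)) := by
  have hm := hx.two_le
  induction i, hi using Nat.le_induction with
  | base =>
    have a0 := hx.mub_ne 1 le_rfl (by omega)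
    have a1 := hy.mub_ne 1 le_rfl (by omega)
    have a2 := hx.tau_ne 0 (by omega)
    have a3 := hx.tau_ne 1 (by omega)
    have a4 := hx.tau'_ne 0 (by omega)
    have a5 := hx.tau'_ne 1 (by omega)
    have a6 := hy.tau'_ne 0 (by omega)
    have a7 := hx.c_ne 1 le_rfl (by omega)
    have a8 := hy.c_ne 1 le_rfl (by omega)
    have v0 := h.Vf_zero hα hx hy
    have v : Vf (m + 2) x xb y yb 1 = yb 1 * (Vf (m + 2) x xb y yb 0 / xb 1
        + (lev (m + 2) x xb - lev (m + 2) y yb) * (1 / x 1 + 1 / yb 1)) := by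
      rw [← zero_add 1]
      conv_lhs => rw [Vf, if_neg (by omega)]
    rw [v, v0, h.inv_add_inv_first hx hy, hx.lev_eq, hy.lev_eq, merge_one, merge_one, hx.firstb,
      hy.firstb]
    generalize (lev (m + 2) lam lamb)⁻¹ - (lev (m + 2) kap kapb)⁻¹ = d
    field_simp
    linear_combination - β * d * h.e31
  | succ i hi ih =>
    have a0 := hx.mub_ne (i + 1) (by omega) (by omega)
    have a1 := hy.mub_ne (i + 1) (by omega) (by omega)
    have a2 := hx.merge_tau_ne (show i ≤ m + 2 by omega)
    have a3 := hx.tau_ne (i + 1) (by omega)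
    have a4 := hx.merge_tau'_ne (show i ≤ m + 2 by omega)
    have a5 := hx.tau'_ne (i + 1) (by omega)
    have a6 := hx.c_ne i hi (by omega)
    have a7 := hy.c_ne i hi (by omega)
    have a8 := hx.c_ne (i + 1) (by omega) him
    have a9 := hy.c_ne (i + 1) (by omega) him
    rw [Vf, if_neg (by omega), ih (by omega), h.inv_add_inv_mid hx hy hi him, hx.lev_eq, hy.lev_eq,
      merge_succ _ hi, merge_succ _ hi, hx.midb i hi him, hy.midb i hi him]
    generalize (lev (m + 2) lam lamb)⁻¹ - (lev (m + 2) kap kapb)⁻¹ = d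
    field_simp
    linear_combination - β * d * h.e3 i hi him

lemma Vf_penult (h : TauSystem m lam lamb kap kapb S W N E t0 t1 t2 t3 t4 α β) (hα : α ≠ 0)
    (hx : IsBracket m lam lamb t3 W t2 x xb) (hy : IsBracket m kap kapb t2 N t1 y yb) :
    Vf (m + 2) x xb y yb (m + 1)
      = β / α * ((lev (m + 2) lam lamb)⁻¹ - (lev (m + 2) kap kapb)⁻¹)
        * (t2 (m + 2) * t4 (m + 2) / (t1 (m + 2) * t3 (m + 2))) := by
  have hm := hx.two_le
  have a0 := hx.mub_ne (m + 1) (by omega) (by omega)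
  have a1 := hy.mub_ne (m + 1) (by omega) (by omega)
  have a2 := hx.c_ne m (by omega) le_rfl
  have a3 := hy.c_ne m (by omega) le_rfl
  have a4 := hx.tau_ne m (by omega)
  have a5 := hx.tau'_ne m (by omega)
  have a6 := hx.tau_ne (m + 2) (by omega)
  have a7 := hx.tau'_ne (m + 2) (by omega)
  have a8 := hy.tau'_ne (m + 2) (by omega)
  have hyn : y (m + 2) ≠ 0 := by
    have b0 := hy.mu_ne (m + 2) (by omega) (by omega)
    have b1 := hy.tau'_ne (m + 1) (by omega)
    have b2 := hy.tau_ne (m + 1) (by omega)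
    rw [hy.last]
    positivity
  rw [Vf, if_pos (by omega), h.inv_add_inv_penult hx hy, h.Vf_mid hα hx hy (by omega) le_rfl,
    hx.lev_eq, hy.lev_eq, merge_of_two_le _ hm, merge_of_two_le _ hm, hx.penultb, hy.penultb]
  generalize (lev (m + 2) lam lamb)⁻¹ - (lev (m + 2) kap kapb)⁻¹ = d
  field_simp
  linear_combination - β * d * h.e3p

lemma Vs1_zero (h : TauSystem m lam lamb kap kapb S W N E t0 t1 t2 t3 t4 α β) (hα : α ≠ 0)
    (hx : IsBracket m lam lamb t3 W t2 x xb) (hy : IsBracket m kap kapb t2 N t1 y yb) :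
    Vs1 (m + 2) x xb y yb 0
      = β / α * ((lev (m + 2) lam lamb)⁻¹ - (lev (m + 2) kap kapb)⁻¹)
        * (t4 1 * t2 1 / (t3 1 * t1 1)) := by
  rw [Vs1, (h.sigma_one hx.two_le).Vf_zero hα hx.sigma_one hy.sigma_one, lev_sw1 hx.two_le,
    lev_sw1 hx.two_le]
  simp [swapFirst]

lemma Vsn_penult (h : TauSystem m lam lamb kap kapb S W N E t0 t1 t2 t3 t4 α β) (hα : α ≠ 0)
    (hx : IsBracket m lam lamb t3 W t2 x xb) (hy : IsBracket m kap kapb t2 N t1 y yb) :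
    Vsn (m + 2) x xb y yb (m + 1)
      = β / α * ((lev (m + 2) lam lamb)⁻¹ - (lev (m + 2) kap kapb)⁻¹)
        * (t2 (m + 1) * t4 (m + 1) / (t1 (m + 1) * t3 (m + 1))) := by
  have hl := hx.mu_ne (m + 2) (by omega) le_rfl
  have hk := hy.mu_ne (m + 2) (by omega) le_rfl
  rw [Vsn, (h.sigma_last hx.two_le hl hk).Vf_penult hα hx.sigma_last hy.sigma_last,
    lev_snx _ _ hl, lev_snx _ _ hk]
  simp only [swapLast_last]

lemma Vst_zero (h : TauSystem m lam lamb kap kapb S W N E t0 t1 t2 t3 t4 α β) (hα : α ≠ 0)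
    (hx : IsBracket m lam lamb t3 W t2 x xb) (hy : IsBracket m kap kapb t2 N t1 y yb) :
    Vst (m + 2) x xb y yb 0
      = β / α * ((lev (m + 2) lam lamb)⁻¹ - (lev (m + 2) kap kapb)⁻¹)
        * (t4 0 * t2 0 / (t3 0 * t1 0)) := by
  rw [Vst, (h.star hx.two_le).Vf_zero (neg_ne_zero.mpr hα) hy.star hx.star, lev_stx, lev_stx]
  simp only [swapLast_of_le _ m.zero_le]
  ring

lemma Vst_mid (h : TauSystem m lam lamb kap kapb S W N E t0 t1 t2 t3 t4 α β) (hα : α ≠ 0)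
    (hx : IsBracket m lam lamb t3 W t2 x xb) (hy : IsBracket m kap kapb t2 N t1 y yb)
    {i : ℕ} (hi : 1 ≤ i) (him : i ≤ m) :
    Vst (m + 2) x xb y yb i
      = β / α * ((lev (m + 2) lam lamb)⁻¹ - (lev (m + 2) kap kapb)⁻¹)
        * (E i * merge t2 i / (merge t1 i * W i)) := by
  rw [Vst, (h.star hx.two_le).Vf_mid (neg_ne_zero.mpr hα) hy.star hx.star hi him, lev_stx, lev_stx]
  simp only [merge_swapLast hx.two_le _ him]
  ring

lemma Vst_penult (h : TauSystem m lam lamb kap kapb S W N E t0 t1 t2 t3 t4 α β) (hα : α ≠ 0)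
    (hx : IsBracket m lam lamb t3 W t2 x xb) (hy : IsBracket m kap kapb t2 N t1 y yb) :
    Vst (m + 2) x xb y yb (m + 1)
      = β / α * ((lev (m + 2) lam lamb)⁻¹ - (lev (m + 2) kap kapb)⁻¹)
        * (t2 (m + 1) * t4 (m + 1) / (t1 (m + 1) * t3 (m + 1))) := by
  rw [Vst, (h.star hx.two_le).Vf_penult (neg_ne_zero.mpr hα) hy.star hx.star, lev_stx, lev_stx]
  simp only [swapLast_last]
  ring

lemma Uf_mid (h : TauSystem m lam lamb kap kapb S W N E t0 t1 t2 t3 t4 α β) (hα : α ≠ 0)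
    (hβ : β ≠ 0) (ht0 : ∀ i ≤ m + 2, t0 i ≠ 0)
    (h4 : ∀ i, 1 ≤ i → i < m →
      kap (i + 1) * E i * S (i + 1) + lamb (i + 1) * S i * E (i + 1) = β * t0 (i + 1) * t4 (i + 1))
    (hx : IsBracket m lam lamb t3 W t2 x xb) (hy : IsBracket m kap kapb t2 N t1 y yb)
    {i : ℕ} (hi : 1 ≤ i) (him : i ≤ m) :
    Uf (m + 2) x xb y yb i
      = (β / α * ((lev (m + 2) lam lamb)⁻¹ - (lev (m + 2) kap kapb)⁻¹)) ^ 2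
        * (merge t2 i * merge t4 i / (merge t1 i * merge t3 i)) := by
  have hm := hx.two_le
  obtain rfl | ⟨j, hj, rfl⟩ : i = 1 ∨ ∃ j, 1 ≤ j ∧ i = j + 1 := by
    rcases Nat.eq_or_lt_of_le hi with e | e
    · exact Or.inl e.symm
    · exact Or.inr ⟨i - 1, by omega, by omega⟩
  · rw [Uf, if_pos rfl, h.Vf_zero hα hx hy, h.Vs1_zero hα hx hy]
    simp only [merge_one]
    ring
  · have a0 := hy.mu_ne (j + 1) (by omega) (by omega)
    have a1 := hx.mub_ne (j + 1) (by omega) (by omega)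
    have a2 := hx.merge_tau_ne (show j ≤ m + 2 by omega)
    have a3 := hx.merge_tau'_ne (show j ≤ m + 2 by omega)
    have a4 := hy.merge_tau'_ne (show j ≤ m + 2 by omega)
    have a5 := hx.tau_ne (j + 1) (by omega)
    have a6 := hx.tau'_ne (j + 1) (by omega)
    have a7 := hy.tau'_ne (j + 1) (by omega)
    have a8 := hx.c_ne j hj (by omega)
    have a9 := hy.c_ne j hj (by omega)
    have b8 := hx.c_ne (j + 1) (by omega) him
    have b9 := hy.c_ne (j + 1) (by omega) him
    have b0 := ht0 (j + 1) (by omega)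
    rw [Uf, if_neg (by omega), if_neg (by omega), Nat.add_sub_cancel,
      h.inv_add_inv_mid hx hy hj him, h.Vf_mid hα hx hy hj (by omega),
      h.Vf_mid hα hx hy (by omega) him, h.Vst_mid hα hx hy hj (by omega),
      h.Vst_mid hα hx hy (by omega) him, hx.midb j hj him, hy.mid j hj him]
    simp only [merge_succ _ hj]
    generalize (lev (m + 2) lam lamb)⁻¹ - (lev (m + 2) kap kapb)⁻¹ = d
    field_simp
    linear_combination d ^ 2 * h4 j hj him

lemma Uf_penult (h : TauSystem m lam lamb kap kapb S W N E t0 t1 t2 t3 t4 α β) (hα : α ≠ 0)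
    (hx : IsBracket m lam lamb t3 W t2 x xb) (hy : IsBracket m kap kapb t2 N t1 y yb) :
    Uf (m + 2) x xb y yb (m + 1)
      = (β / α * ((lev (m + 2) lam lamb)⁻¹ - (lev (m + 2) kap kapb)⁻¹)) ^ 2
        * (t2 (m + 1) * t4 (m + 1) / (t1 (m + 1) * t3 (m + 1))
          * (t2 (m + 2) * t4 (m + 2) / (t1 (m + 2) * t3 (m + 2)))) := by
  have hm := hx.two_le
  rw [Uf, if_neg (by omega), if_pos (by omega), show m + 2 - 1 = m + 1 by omega,
    h.Vf_penult hα hx hy, h.Vst_penult hα hx hy]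
  ring

end TauSystem

lemma isBracket_brk {μ μb τ C τ' : ℕ → F} (hm : 2 ≤ m)
    (hμ : ∀ i, 1 ≤ i → i ≤ m + 2 → μ i ≠ 0) (hμb : ∀ i, 1 ≤ i → i ≤ m + 1 → μb i ≠ 0)
    (hτ : ∀ i ≤ m + 2, τ i ≠ 0) (hC : ∀ i, 1 ≤ i → i ≤ m → C i ≠ 0)
    (hτ' : ∀ i ≤ m + 2, τ' i ≠ 0) :
    IsBracket m μ μb τ C τ' (brkX (m + 2) μ τ C τ') (brkXb (m + 2) μb τ C τ') where
  two_le := hm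
  mu_ne := hμ
  mub_ne := hμb
  tau_ne := hτ
  tau'_ne := hτ'
  c_ne := hC
  first := by simp [brkX]
  firstb := by simp [brkXb]
  mid i h1 h2 := by
    obtain rfl | h : i = 1 ∨ 2 ≤ i := by omega
    · simp [brkX, merge_one, mul_assoc]
    · simp [brkX, merge_of_two_le _ h, show i ≠ 0 by omega, show i ≠ 1 by omega,
        show i ≠ m by omega, show i ≠ m + 1 by omega]
  midb i h1 h2 := by
    obtain rfl | h : i = 1 ∨ 2 ≤ i := by omega
    · simp [brkXb, merge_one, mul_assoc]
    · simp [brkXb, merge_of_two_le _ h, show i ≠ 0 by omega, show i ≠ 1 by omega,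
        show i ≠ m by omega]
  penult := by simp [brkX, show m ≠ 0 by omega, show m ≠ 1 by omega]
  penultb := by simp [brkXb, show m ≠ 0 by omega, show m ≠ 1 by omega]
  last := by simp [brkX, show m ≠ 0 by omega]

lemma tauSystem_of_BE {lam lamb kap kapb S W N E t0 t1 t2 t3 t4 : ℕ → F} {α β : F} (hm : 2 ≤ m)
    (heqs : ∀ J i, 1 ≤ J → J ≤ 4 → i ≤ m + 2 →
      BE (m + 2) lam lamb kap kapb S W N E t0 t1 t2 t3 t4 α β J i) :
    TauSystem m lam lamb kap kapb S W N E t0 t1 t2 t3 t4 α β where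
  e10 := by simpa [BE] using heqs 1 0 (by omega) (by omega) (by omega)
  e11 := by simpa [BE] using heqs 1 1 (by omega) (by omega) (by omega)
  e1 i h1 h2 := by
    simpa [BE, show i ≠ 0 by omega, show i ≠ m by omega, show i ≠ m + 1 by omega]
      using heqs 1 (i + 1) (by omega) (by omega) (by omega)
  e1p := by simpa [BE, show m ≠ 0 by omega] using heqs 1 (m + 1) (by omega) (by omega) (by omega)
  e1l := by simpa [BE] using heqs 1 (m + 2) (by omega) (by omega) (by omega)
  e20 := by simpa [BE] using heqs 2 0 (by omega) (by omega) (by omega)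
  e21 := by simpa [BE] using heqs 2 1 (by omega) (by omega) (by omega)
  e2 i h1 h2 := by
    simpa [BE, show i ≠ 0 by omega, show i ≠ m by omega, show i ≠ m + 1 by omega]
      using heqs 2 (i + 1) (by omega) (by omega) (by omega)
  e2p := by simpa [BE, show m ≠ 0 by omega] using heqs 2 (m + 1) (by omega) (by omega) (by omega)
  e2l := by simpa [BE] using heqs 2 (m + 2) (by omega) (by omega) (by omega)
  e30 := by simpa [BE] using heqs 3 0 (by omega) (by omega) (by omega)
  e31 := by simpa [BE] using heqs 3 1 (by omega) (by omega) (by omega)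
  e3 i h1 h2 := by
    simpa [BE, show i ≠ 0 by omega, show i ≠ m by omega, show i ≠ m + 1 by omega]
      using heqs 3 (i + 1) (by omega) (by omega) (by omega)
  e3p := by simpa [BE, show m ≠ 0 by omega] using heqs 3 (m + 1) (by omega) (by omega) (by omega)
  e3l := by simpa [BE] using heqs 3 (m + 2) (by omega) (by omega) (by omega)

end Auxiliary

theorem stmt13 {F : Type*} [Field F] (n : ℕ) (hn : 4 ≤ n)
    (lam lamb kap kapb : ℕ → F) (α β : F)
    (hlam : ∀ i, 1 ≤ i → i ≤ n → lam i ≠ 0)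
    (hlamb : ∀ i, 1 ≤ i → i ≤ n - 1 → lamb i ≠ 0)
    (hkap : ∀ i, 1 ≤ i → i ≤ n → kap i ≠ 0)
    (hkapb : ∀ i, 1 ≤ i → i ≤ n - 1 → kapb i ≠ 0)
    (l k : F)
    (hl : l = (∏ i ∈ Finset.Icc 1 n, lam i) * ∏ i ∈ Finset.Icc 1 (n - 1), lamb i)
    (hk : k = (∏ i ∈ Finset.Icc 1 n, kap i) * ∏ i ∈ Finset.Icc 1 (n - 1), kapb i)
    (hlk : l * k * (l - k) ≠ 0)
    (hα : α ≠ 0) (hβ : β ≠ 0)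
    (S W N E t0 t1 t2 t3 t4 : ℕ → F)
    (hS : ∀ i, 1 ≤ i → i ≤ n - 2 → S i ≠ 0)
    (hW : ∀ i, 1 ≤ i → i ≤ n - 2 → W i ≠ 0)
    (hN : ∀ i, 1 ≤ i → i ≤ n - 2 → N i ≠ 0)
    (hE : ∀ i, 1 ≤ i → i ≤ n - 2 → E i ≠ 0)
    (ht0 : ∀ i ≤ n, t0 i ≠ 0) (ht1 : ∀ i ≤ n, t1 i ≠ 0) (ht2 : ∀ i ≤ n, t2 i ≠ 0)
    (ht3 : ∀ i ≤ n, t3 i ≠ 0) (ht4 : ∀ i ≤ n, t4 i ≠ 0)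
    (heqs : ∀ J i, 1 ≤ J → J ≤ 4 → i ≤ n →
      BE n lam lamb kap kapb S W N E t0 t1 t2 t3 t4 α β J i)
    (x xb y yb x' xb' y' yb' : ℕ → F)
    (hx : x = brkX n lam t3 W t2) (hxb : xb = brkXb n lamb t3 W t2)
    (hy : y = brkX n kap t2 N t1) (hyb : yb = brkXb n kapb t2 N t1)
    (hx' : x' = brkX n kap t3 S t4) (hxb' : xb' = brkXb n kapb t3 S t4)
    (hy' : y' = brkX n lam t4 E t1) (hyb' : yb' = brkXb n lamb t4 E t1) :
    Adm n x xb y yb ∧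
    (∀ i, 1 ≤ i → i ≤ n → Rx n x xb y yb i = x' i) ∧
    (∀ i, 1 ≤ i → i ≤ n - 1 → Rxb n x xb y yb i = xb' i) ∧
    (∀ i, 1 ≤ i → i ≤ n → Ry n x xb y yb i = y' i) ∧
    (∀ i, 1 ≤ i → i ≤ n - 1 → Ryb n x xb y yb i = yb' i) := by
  obtain ⟨m, rfl⟩ : ∃ m, n = m + 2 := ⟨n - 2, by omega⟩
  have hm : 2 ≤ m := by omega
  simp only [show m + 2 - 1 = m + 1 by omega, show m + 2 - 2 = m by omega] at *
  have brx : IsBracket m lam lamb t3 W t2 x xb := hx ▸ hxb ▸ isBracket_brk hm hlam hlamb ht3 hW ht2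
  have bry : IsBracket m kap kapb t2 N t1 y yb := hy ▸ hyb ▸ isBracket_brk hm hkap hkapb ht2 hN ht1
  have brx' : IsBracket m kap kapb t3 S t4 x' xb' :=
    hx' ▸ hxb' ▸ isBracket_brk hm hkap hkapb ht3 hS ht4
  have bry' : IsBracket m lam lamb t4 E t1 y' yb' :=
    hy' ▸ hyb' ▸ isBracket_brk hm hlam hlamb ht4 hE ht1
  have h := tauSystem_of_BE hm heqs
  have h4 : ∀ i, 1 ≤ i → i < m →
      kap (i + 1) * E i * S (i + 1) + lamb (i + 1) * S i * E (i + 1)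
        = β * t0 (i + 1) * t4 (i + 1) := fun i h1 h2 => by
    have := heqs 4 (i + 1) (by omega) (by omega) (by omega)
    simpa [BE, show i ≠ 0 by omega, show i ≠ m by omega, show i ≠ m + 1 by omega] using this
  clear heqs hx hxb hy hyb hx' hxb' hy' hyb'
  obtain ⟨c, hc⟩ : ∃ c, c = β / α * ((lev (m + 2) lam lamb)⁻¹ - (lev (m + 2) kap kapb)⁻¹) :=
    ⟨_, rfl⟩
  have hl' : lev (m + 2) lam lamb = l := by rw [hl, lev, show m + 2 - 1 = m + 1 by omega]
  have hk' : lev (m + 2) kap kapb = k := by rw [hk, lev, show m + 2 - 1 = m + 1 by omega]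
  have hc0 : c ≠ 0 := by
    have hl0 : l ≠ 0 := fun e => hlk (by rw [e]; ring)
    have hk0 : k ≠ 0 := fun e => hlk (by rw [e]; ring)
    rw [hc, hl', hk']
    refine mul_ne_zero (div_ne_zero hβ hα) fun e => hlk ?_
    rw [inv_injective (sub_eq_zero.mp e)]
    ring
  have v0 := h.Vf_zero hα brx bry
  have v1 := fun i hi him => h.Vf_mid hα brx bry (i := i) hi him
  have v2 := h.Vf_penult hα brx bry
  have w0 := h.Vst_zero hα brx bry
  have w1 := fun i hi him => h.Vst_mid hα brx bry (i := i) hi him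
  have w2 := h.Vst_penult hα brx bry
  have vs := h.Vs1_zero hα brx bry
  have vn := h.Vsn_penult hα brx bry
  have u1 := fun i hi him => h.Uf_mid hα hβ ht0 h4 brx bry (i := i) hi him
  have u2 := h.Uf_penult hα brx bry
  simp only [← hc] at v0 v1 v2 w0 w1 w2 vs vn u1 u2
  have m1 := fun i (hi : i ≤ m + 2) => merge_ne_zero ht1 hi
  have m2 := fun i (hi : i ≤ m + 2) => merge_ne_zero ht2 hi
  have m3 := fun i (hi : i ≤ m + 2) => merge_ne_zero ht3 hi
  have m4 := fun i (hi : i ≤ m + 2) => merge_ne_zero ht4 hi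
  have split : ∀ i, 1 ≤ i → i ≤ m + 1 → i = 1 ∨ (∃ j, 1 ≤ j ∧ j < m ∧ i = j + 1) ∨ i = m + 1 := by
    intro i h1 h2
    by_cases e : i = 1
    · exact Or.inl e
    · by_cases e' : i = m + 1
      · exact Or.inr (Or.inr e')
      · exact Or.inr (Or.inl ⟨i - 1, by omega, by omega, by omega⟩)
  have p0 : 0 ≤ m + 2 := by omega
  have p1 : 1 ≤ m + 2 := by omega
  have pm : m ≤ m + 2 := by omega
  have pm1 : m + 1 ≤ m + 2 := by omega
  have q1 : 1 ≤ m := by omega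
  have t10 := ht1 0 p0
  have t20 := ht2 0 p0
  have t30 := ht3 0 p0
  have t40 := ht4 0 p0
  have t11 := ht1 1 p1
  have t21 := ht2 1 p1
  have t31 := ht3 1 p1
  have t41 := ht4 1 p1
  have t1m := ht1 m pm
  have t2m := ht2 m pm
  have t3m := ht3 m pm
  have t4m := ht4 m pm
  have t1p := ht1 (m + 1) pm1
  have t2p := ht2 (m + 1) pm1
  have t3p := ht3 (m + 1) pm1
  have t4p := ht4 (m + 1) pm1
  have t1l := ht1 (m + 2) le_rfl
  have t2l := ht2 (m + 2) le_rfl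
  have t3l := ht3 (m + 2) le_rfl
  have t4l := ht4 (m + 2) le_rfl
  have s1 := hS 1 le_rfl q1
  have w1' := hW 1 le_rfl q1
  have n1 := hN 1 le_rfl q1
  have e1 := hE 1 le_rfl q1
  have sm := hS m q1 le_rfl
  have wm := hW m q1 le_rfl
  have nm := hN m q1 le_rfl
  have em := hE m q1 le_rfl
  refine ⟨⟨fun i hi => ?_, fun i hi => ?_, ?_, ?_, fun i h1 hi => ?_⟩, fun i h1 hi => ?_,
    fun i h1 hi => ?_, fun i h1 hi => ?_, fun i h1 hi => ?_⟩
  · obtain rfl | ⟨j1, jm⟩ | rfl : i = 0 ∨ (1 ≤ i ∧ i ≤ m) ∨ i = m + 1 := by omega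
    · rw [v0]
      positivity
    · have := m2 i (by omega)
      have := m3 i (by omega)
      have := hS i j1 jm
      have := hN i j1 jm
      rw [v1 i j1 jm]
      positivity
    · rw [v2]
      positivity
  · obtain rfl | ⟨j1, jm⟩ | rfl : i = 0 ∨ (1 ≤ i ∧ i ≤ m) ∨ i = m + 1 := by omega
    · rw [w0]
      positivity
    · have := m2 i (by omega)
      have := m1 i (by omega)
      have := hE i j1 jm
      have := hW i j1 jm
      rw [w1 i j1 jm]
      positivity
    · rw [w2]
      positivity
  · rw [vs]
    positivity
  · rw [show m + 2 - 1 = m + 1 by omega, vn]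
    positivity
  · obtain jm | rfl : i ≤ m ∨ i = m + 1 := by omega
    · have := m1 i (by omega)
      have := m2 i (by omega)
      have := m3 i (by omega)
      have := m4 i (by omega)
      rw [u1 i h1 jm]
      positivity
    · rw [u2]
      positivity
  · obtain rfl | hi' : i = m + 2 ∨ i ≤ m + 1 := by omega
    · rw [Rx, if_neg (by omega), if_pos rfl, show m + 2 - 1 = m + 1 by omega, v2, vn, brx'.last,
        bry.last]
      field_simp
    obtain rfl | ⟨j, j1, jm, rfl⟩ | rfl := split i h1 hi'
    · rw [Rx, if_pos rfl, vs, v1 1 le_rfl q1, brx'.first, bry.first, merge_one, merge_one]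
      field_simp
    · have r1 := m1 j (by omega)
      have r2 := m2 j (by omega)
      have r3 := m3 j (by omega)
      have r4 := m4 j (by omega)
      have r1' := ht1 (j + 1) (by omega)
      have r2' := ht2 (j + 1) (by omega)
      have r3' := ht3 (j + 1) (by omega)
      have r5 := hS j j1 jm.le
      have r6 := hN j j1 jm.le
      have r7 := hN (j + 1) (by omega) jm
      rw [Rx, if_neg (by omega), if_neg (by omega), Nat.add_sub_cancel, v1 j j1 jm.le,
        v1 (j + 1) (by omega) jm, u1 j j1 jm.le, u1 (j + 1) (by omega) jm, brx'.mid j j1 jm,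
        bry.mid j j1 jm]
      simp only [merge_succ _ j1]
      field_simp
    · rw [Rx, if_neg (by omega), if_neg (by omega), Nat.add_sub_cancel, v1 m q1 le_rfl, v2,
        u1 m q1 le_rfl, u2, brx'.penult, bry.penult]
      simp only [merge_of_two_le _ hm]
      field_simp
  · obtain rfl | ⟨j, j1, jm, rfl⟩ | rfl := split i h1 hi
    · rw [Rxb, if_pos rfl, v0, v1 1 le_rfl q1, brx'.firstb, bry.firstb, merge_one, merge_one]
      field_simp
    · have r2 := m2 j (by omega)
      have r3 := m3 j (by omega)
      have r2' := ht2 (j + 1) (by omega)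
      have r3' := ht3 (j + 1) (by omega)
      have r5 := hS j j1 jm.le
      have r6 := hN j j1 jm.le
      have r7 := hN (j + 1) (by omega) jm
      rw [Rxb, if_neg (by omega), Nat.add_sub_cancel, v1 j j1 jm.le, v1 (j + 1) (by omega) jm,
        brx'.midb j j1 jm, bry.midb j j1 jm]
      simp only [merge_succ _ j1]
      field_simp
    · rw [Rxb, if_neg (by omega), Nat.add_sub_cancel, v1 m q1 le_rfl, v2, brx'.penultb, bry.penultb]
      simp only [merge_of_two_le _ hm]
      field_simp
  · obtain rfl | hi' : i = m + 2 ∨ i ≤ m + 1 := by omega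
    · rw [Ry, if_neg (by omega), if_pos rfl, show m + 2 - 1 = m + 1 by omega, v2, vn, bry'.last,
        brx.last]
      field_simp
    obtain rfl | ⟨j, j1, jm, rfl⟩ | rfl := split i h1 hi'
    · rw [Ry, if_pos rfl, v0, w1 1 le_rfl q1, bry'.first, brx.first, merge_one, merge_one]
      field_simp
    · have r1 := m1 j (by omega)
      have r2 := m2 j (by omega)
      have r1' := ht1 (j + 1) (by omega)
      have r2' := ht2 (j + 1) (by omega)
      have r5 := hE j j1 jm.le
      have r6 := hW j j1 jm.le
      have r7 := hW (j + 1) (by omega) jm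
      rw [Ry, if_neg (by omega), if_neg (by omega), Nat.add_sub_cancel, w1 j j1 jm.le,
        w1 (j + 1) (by omega) jm, bry'.mid j j1 jm, brx.mid j j1 jm]
      simp only [merge_succ _ j1]
      field_simp
    · rw [Ry, if_neg (by omega), if_neg (by omega), Nat.add_sub_cancel, w1 m q1 le_rfl, w2,
        bry'.penult, brx.penult]
      simp only [merge_of_two_le _ hm]
      field_simp
  · obtain rfl | ⟨j, j1, jm, rfl⟩ | rfl := split i h1 hi
    · rw [Ryb, if_pos rfl, vs, w1 1 le_rfl q1, bry'.firstb, brx.firstb, merge_one, merge_one]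
      field_simp
    · have r1 := m1 j (by omega)
      have r2 := m2 j (by omega)
      have r3 := m3 j (by omega)
      have r4 := m4 j (by omega)
      have r1' := ht1 (j + 1) (by omega)
      have r2' := ht2 (j + 1) (by omega)
      have r3' := ht3 (j + 1) (by omega)
      have r5 := hE j j1 jm.le
      have r6 := hW j j1 jm.le
      have r7 := hW (j + 1) (by omega) jm
      rw [Ryb, if_neg (by omega), Nat.add_sub_cancel, w1 j j1 jm.le, w1 (j + 1) (by omega) jm,
        u1 j j1 jm.le, u1 (j + 1) (by omega) jm, bry'.midb j j1 jm, brx.midb j j1 jm]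
      simp only [merge_succ _ j1]
      field_simp
    · rw [Ryb, if_neg (by omega), Nat.add_sub_cancel, w1 m q1 le_rfl, w2, u1 m q1 le_rfl, u2,
        bry'.penultb, brx.penultb]
      simp only [merge_of_two_le _ hm]
      field_simp
end

section
/- With x′_i = y_i·P_i(x,y)/P_{i−1}(x,y) and y′_i = x_i·P_{i−1}(x,y)/P_i(x,y), the following hold for all i ∈ ℤ/nℤ: (i) x_i·y_i = x′_i·y′_i; (ii) 1/x_i + 1/y_{i+1} = 1/x′_i + 1/y′_{i+1}; (iii) Π_{i=1}^{n} (x_i/y′_i) = 1 and Π_{i=1}^{n} (y_i/x′_i) = 1. -/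
namespace TropicalR

/-- A cyclic product over `ℤ/nℤ` does not depend on its starting point. -/
theorem prod_range_add_one_shift {M : Type*} [CommMonoid M] {n : ℕ} (f : ZMod n → M)
    (i : ZMod n) :
    ∏ j ∈ Finset.range n, f (i + ((j + 1 : ℕ) : ZMod n))
      = ∏ j ∈ Finset.range n, f (i + (j : ZMod n)) := by
  cases n with
  | zero => simp
  | succ m =>
    rw [Finset.prod_range_succ, Finset.prod_range_succ' (fun j : ℕ => f (i + (j : ZMod (m + 1))))]
    simp only [ZMod.natCast_self, Nat.cast_zero]

theorem sum_Icc_one {M : Type*} [AddCommMonoid M] (f : ℕ → M) (n : ℕ) :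
    ∑ k ∈ Finset.Icc 1 n, f k = ∑ k ∈ Finset.range n, f (k + 1) := by
  rw [← Finset.Ico_add_one_right_eq_Icc, Finset.sum_Ico_eq_sum_range]
  simp [add_comm]

theorem prod_Icc_one {M : Type*} [CommMonoid M] (f : ℕ → M) (n : ℕ) :
    ∏ k ∈ Finset.Icc 1 n, f k = ∏ k ∈ Finset.range n, f (k + 1) := by
  rw [← Finset.Ico_add_one_right_eq_Icc, Finset.prod_Ico_eq_prod_range]
  simp [add_comm]

/-- The polynomial `P_i(x, y)`. -/
def P {R : Type*} [CommRing R] {n : ℕ} (x y : ZMod n → R) (i : ZMod n) : R :=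
  ∑ k ∈ Finset.Icc 1 n,
    (∏ j ∈ Finset.Icc k n, x (i + (j : ZMod n))) * ∏ j ∈ Finset.Icc 1 k, y (i + (j : ZMod n))

/-- The product `x_i ⋯ x_{i+n-1}` with its first `k` factors replaced by `y_{i+1} ⋯ y_{i+k}`. -/
def mixedProd {R : Type*} [CommRing R] {n : ℕ} (x y : ZMod n → R) (i : ZMod n) (k : ℕ) : R :=
  (∏ j ∈ Finset.Ico k n, x (i + (j : ZMod n)))
    * ∏ j ∈ Finset.range k, y (i + ((j + 1 : ℕ) : ZMod n))

variable {R : Type*} [CommRing R] {n : ℕ} (x y : ZMod n → R) (i : ZMod n)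

theorem P_eq_mul_sum_mixedProd :
    P x y i = x i * ∑ k ∈ Finset.range n, mixedProd x y i (k + 1) := by
  rw [P, sum_Icc_one, Finset.mul_sum]
  refine Finset.sum_congr rfl fun k hk => ?_
  have hkn : k + 1 ≤ n := Finset.mem_range.mp hk
  rw [mixedProd, prod_Icc_one, ← Finset.Ico_add_one_right_eq_Icc, Finset.prod_Ico_succ_top hkn,
    ZMod.natCast_self, add_zero]
  ring

theorem P_sub_one_eq_mul_sum_mixedProd :
    P x y (i - 1) = y i * ∑ k ∈ Finset.range n, mixedProd x y i k := by
  have shift (j : ℕ) : i - 1 + ((j + 1 : ℕ) : ZMod n) = i + (j : ZMod n) := by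
    push_cast; ring
  rw [P, sum_Icc_one, Finset.mul_sum]
  refine Finset.sum_congr rfl fun k _ => ?_
  rw [mixedProd, prod_Icc_one, ← Finset.Ico_add_one_right_eq_Icc,
    ← Finset.prod_Ico_add' (fun j : ℕ => x (i - 1 + (j : ZMod n))) k n 1,
    Finset.prod_range_succ']
  simp only [shift, Nat.cast_zero, add_zero]
  ring

theorem mul_P_sub_mul_P_sub_one :
    y i * P x y i - x i * P x y (i - 1) = x i * y i *
      (∏ j ∈ Finset.range n, y (i + (j : ZMod n))
        - ∏ j ∈ Finset.range n, x (i + (j : ZMod n))) := by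
  have telescope := Finset.sum_range_sub (mixedProd x y i) n
  have last : mixedProd x y i n = ∏ j ∈ Finset.range n, y (i + (j : ZMod n)) := by
    simp only [mixedProd, Finset.Ico_self, Finset.prod_empty, one_mul, prod_range_add_one_shift]
  have first : mixedProd x y i 0 = ∏ j ∈ Finset.range n, x (i + (j : ZMod n)) := by
    simp [mixedProd]
  rw [last, first, Finset.sum_sub_distrib] at telescope
  rw [P_eq_mul_sum_mixedProd, P_sub_one_eq_mul_sum_mixedProd]
  linear_combination x i * y i * telescope

theorem prod_div_sub_one_eq_one {F : Type*} [Field F] {n : ℕ} (f : ZMod n → F)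
    (hf : ∀ i, f i ≠ 0) :
    ∏ i ∈ Finset.Icc 1 n, f (i : ZMod n) / f ((i : ZMod n) - 1) = 1 := by
  rw [prod_Icc_one, Finset.prod_div_distrib]
  simp only [Nat.cast_add, Nat.cast_one, add_sub_cancel_right]
  have h := prod_range_add_one_shift f 0
  simp only [zero_add, Nat.cast_add, Nat.cast_one] at h
  rw [h]
  exact div_self (Finset.prod_ne_zero_iff.mpr fun _ _ => hf _)

end TropicalR

theorem stmt16 {F : Type*} [Field F] (n : ℕ) (hn : 2 ≤ n)
    (x y : ZMod n → F)
    (hx : ∀ i, x i ≠ 0) (hy : ∀ i, y i ≠ 0)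
    (P : ZMod n → F)
    (hP : ∀ i, P i = ∑ k ∈ Finset.Icc 1 n,
      (∏ j ∈ Finset.Icc k n, x (i + (j : ZMod n))) * ∏ j ∈ Finset.Icc 1 k, y (i + (j : ZMod n)))
    (hPne : ∀ i, P i ≠ 0)
    (x' y' : ZMod n → F)
    (hx' : ∀ i, x' i = y i * P i / P (i - 1))
    (hy' : ∀ i, y' i = x i * P (i - 1) / P i) :
    (∀ i, x i * y i = x' i * y' i) ∧
    (∀ i, 1 / x i + 1 / y (i + 1) = 1 / x' i + 1 / y' (i + 1)) ∧
    (∏ i ∈ Finset.Icc 1 n, x (i : ZMod n) / y' (i : ZMod n)) = 1 ∧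
    (∏ i ∈ Finset.Icc 1 n, y (i : ZMod n) / x' (i : ZMod n)) = 1 := by
  obtain rfl : P = TropicalR.P x y := funext hP
  refine ⟨fun i => ?_, fun i => ?_, ?_, ?_⟩
  · have := hPne i
    have := hPne (i - 1)
    rw [hx', hy']
    field_simp
  · have h := TropicalR.mul_P_sub_mul_P_sub_one x y i
    have h' := TropicalR.mul_P_sub_mul_P_sub_one x y (i + 1)
    have shift (f : ZMod n → F) : ∏ j ∈ Finset.range n, f (i + 1 + (j : ZMod n))
        = ∏ j ∈ Finset.range n, f (i + (j : ZMod n)) := by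
      rw [← TropicalR.prod_range_add_one_shift f i]
      exact Finset.prod_congr rfl fun j _ => by push_cast; ring_nf
    rw [shift, shift, add_sub_cancel_right] at h'
    have := hPne i
    have := hPne (i - 1)
    have := hPne (i + 1)
    have := hx i
    have := hy i
    have := hx (i + 1)
    have := hy (i + 1)
    rw [hx', hy', add_sub_cancel_right]
    field_simp
    linear_combination x (i + 1) * y (i + 1) * h - x i * y i * h'
  · rw [← TropicalR.prod_div_sub_one_eq_one _ hPne]
    refine Finset.prod_congr rfl fun i _ => ?_
    have := hx i
    rw [hy']
    field_simp
  · rw [← inv_inj, inv_one, ← Finset.prod_inv_distrib,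
      ← TropicalR.prod_div_sub_one_eq_one _ hPne]
    refine Finset.prod_congr rfl fun i _ => ?_
    have := hy i
    rw [hx']
    field_simp
end

section
/- Suppose the Hirota-type bilinear equation λ_i·τ2_{i−1}·τ4_i − κ_i·τ2_i·τ4_{i−1} = α·τ1_i·τ3_{i−1} holds for all i ∈ ℤ/nℤ. Then with x_i, y_i, x′_i, y′_i defined via the tau functions as in the context, one has for all i ∈ ℤ/nℤ: (i) x_i·y_i = x′_i·y′_i; (ii) 1/x_i + 1/y_{i+1} = 1/x′_i + 1/y′_{i+1}. -/
theorem stmt17 {F : Type*} [Field F] (n : ℕ) (hn : 2 ≤ n)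
    (t1 t2 t3 t4 lam kap : ZMod n → F) (α : F)
    (ht1 : ∀ i, t1 i ≠ 0) (ht2 : ∀ i, t2 i ≠ 0) (ht3 : ∀ i, t3 i ≠ 0) (ht4 : ∀ i, t4 i ≠ 0)
    (hlam : ∀ i, lam i ≠ 0) (hkap : ∀ i, kap i ≠ 0) (hα : α ≠ 0)
    (x y x' y' : ZMod n → F)
    (hx : ∀ i, (x i)⁻¹ = lam i * (t3 i / t3 (i - 1)) / (t2 i / t2 (i - 1)))
    (hy : ∀ i, (y i)⁻¹ = kap i * (t2 i / t2 (i - 1)) / (t1 i / t1 (i - 1)))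
    (hx' : ∀ i, (x' i)⁻¹ = kap i * (t3 i / t3 (i - 1)) / (t4 i / t4 (i - 1)))
    (hy' : ∀ i, (y' i)⁻¹ = lam i * (t4 i / t4 (i - 1)) / (t1 i / t1 (i - 1)))
    (hhirota : ∀ i, lam i * t2 (i - 1) * t4 i - kap i * t2 i * t4 (i - 1)
      = α * t1 i * t3 (i - 1)) :
    (∀ i, x i * y i = x' i * y' i) ∧
    (∀ i, 1 / x i + 1 / y (i + 1) = 1 / x' i + 1 / y' (i + 1)) := by
  have hxsub : ∀ i, (x i)⁻¹ - (x' i)⁻¹ = α * t1 i * t3 i / (t2 i * t4 i) := by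
    intro i
    have h2 := ht2 i
    have h2p := ht2 (i - 1)
    have h3p := ht3 (i - 1)
    have h4 := ht4 i
    have h4p := ht4 (i - 1)
    rw [hx, hx']
    field_simp
    linear_combination t3 i * hhirota i
  have hysub : ∀ i, (y' i)⁻¹ - (y i)⁻¹ =
      α * t1 (i - 1) * t3 (i - 1) / (t2 (i - 1) * t4 (i - 1)) := by
    intro i
    have h1 := ht1 i
    have h1p := ht1 (i - 1)
    have h2p := ht2 (i - 1)
    have h4p := ht4 (i - 1)
    rw [hy, hy']
    field_simp
    linear_combination hhirota i
  refine ⟨fun i => ?_, fun i => ?_⟩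
  · apply inv_injective
    have h2 := ht2 i
    have h2p := ht2 (i - 1)
    have h4 := ht4 i
    have h4p := ht4 (i - 1)
    rw [mul_inv, mul_inv, hx, hy, hx', hy']
    field_simp
  · have h := hysub (i + 1)
    rw [add_sub_cancel_right] at h
    simp only [one_div]
    linear_combination hxsub i - h
end
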